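/- arXiv:1506.08962 — 12 statements merged into one kernel-verified Lean document; each statement's English description precedes it below -/
import Mathlib

section
/- Let m, p ≥ 1 and let T be the (m+p)×(m+p) complex block matrix T = [[T1, R],[0, T2]], where T1 is an invertible m×m complex matrix, T2 is a nilpotent p×p complex matrix, and R is an m×p complex matrix. Then T is a product of three positive semi-definite matrices if and only if either (a) R ≠ 0 or T2 ≠ 0, or (b) R = 0, T2 = 0, and T1 is a product of three positive definite matrices. -/
open scoped Matrix ComplexOrder

namespace Matrix

section NecessaryCondition

variable {l n : Type*} [Fintype l] [Fintype n] [DecidableEq l] [DecidableEq n]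

/-- A Hermitian matrix has a generalized inverse. -/
lemma IsHermitian.exists_mul_mul_self_eq {C : Matrix n n ℂ} (hC : C.IsHermitian) :
    ∃ D : Matrix n n ℂ, C * D * C = C := by
  set U : Matrix n n ℂ := hC.eigenvectorUnitary.1
  set d : n → ℂ := RCLike.ofReal ∘ hC.eigenvalues
  have hU : star U * U = 1 := Unitary.coe_star_mul_self hC.eigenvectorUnitary
  have hspec : C = U * diagonal d * star U := by
    exact hC.spectral_theorem.trans (Unitary.conjStarAlgAut_apply _ _)
  have hd : diagonal d * diagonal (fun i => (d i)⁻¹) * diagonal d = diagonal d := by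
    simp only [diagonal_mul_diagonal, diagonal_eq_diagonal_iff]
    exact fun i => mul_inv_mul_cancel (d i)
  refine ⟨U * diagonal (fun i => (d i)⁻¹) * star U, ?_⟩
  calc C * (U * diagonal (fun i => (d i)⁻¹) * star U) * C
      = U * (diagonal d * (star U * U) * diagonal (fun i => (d i)⁻¹) * (star U * U) *
          diagonal d) * star U := by
        rw [hspec]; simp only [Matrix.mul_assoc]
    _ = C := by rw [hU, Matrix.mul_one, Matrix.mul_one, hd, ← hspec]

/-- The generalized Schur complement decomposition of a positive semidefinite block matrix. -/
lemma PosSemidef.exists_eq_fromBlocks {P : Matrix (l ⊕ n) (l ⊕ n) ℂ} (hP : P.PosSemidef) :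
    ∃ (A : Matrix l l ℂ) (C : Matrix n n ℂ) (g : Matrix l n ℂ), A.PosSemidef ∧
      P = fromBlocks (A + g * C * gᴴ) (g * C) (C * gᴴ) C := by
  obtain ⟨A, B, B', C, rfl⟩ : ∃ A B B' C, P = fromBlocks A B B' C :=
    ⟨_, _, _, _, (fromBlocks_toBlocks P).symm⟩
  obtain ⟨hA, hB, -, hC⟩ := isHermitian_fromBlocks_iff.1 hP.1
  obtain ⟨D, hD⟩ := hC.exists_mul_mul_self_eq
  open scoped MatrixOrder in
  obtain ⟨M, hM⟩ := CStarAlgebra.nonneg_iff_eq_star_mul_self.mp hP.nonneg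
  have hCM : C = M.toCols₂ᴴ * M.toCols₂ := by
    ext i j
    simpa [mul_apply] using congr_fun₂ hM (Sum.inr i) (Sum.inr j)
  have hBM : B = M.toCols₁ᴴ * M.toCols₂ := by
    ext i j
    simpa [mul_apply] using congr_fun₂ hM (Sum.inl i) (Sum.inr j)
  have hBD : B * D * C = B := by
    have h : M.toCols₂ᴴ * M.toCols₂ * (D * C - 1) = 0 := by
      rw [← hCM, Matrix.mul_sub, ← Matrix.mul_assoc, hD, Matrix.mul_one, sub_self]
    rw [conjTranspose_mul_self_mul_eq_zero] at h
    have h' : B * (D * C - 1) = 0 := by rw [hBM, Matrix.mul_assoc, h, Matrix.mul_zero]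
    rwa [Matrix.mul_sub, Matrix.mul_one, sub_eq_zero, ← Matrix.mul_assoc] at h'
  set g := B * D
  have hB' : B' = C * gᴴ := by
    rw [← hB, ← hBD, conjTranspose_mul, hC.eq]
  refine ⟨A - g * C * gᴴ, C, g, ?_, by rw [sub_add_cancel, hBD, hB']⟩
  have := hP.mul_mul_conjTranspose_same (fromCols (1 : Matrix l l ℂ) (-g))
  convert this using 1
  rw [fromCols_mul_fromBlocks, conjTranspose_fromCols_eq_fromRows_conjTranspose,
    fromCols_mul_fromRows, hB', ← hBD]
  simp [Matrix.mul_assoc, sub_eq_add_neg]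

omit [DecidableEq n] in
lemma PosSemidef.fromBlocks_zero {A : Matrix l l ℂ} (hA : A.PosSemidef) :
    (fromBlocks A 0 0 0 : Matrix (l ⊕ n) (l ⊕ n) ℂ).PosSemidef := by
  have := hA.mul_mul_conjTranspose_same (fromRows (1 : Matrix l l ℂ) (0 : Matrix n l ℂ))
  rw [fromRows_mul, conjTranspose_fromRows_eq_fromCols_conjTranspose, fromRows_mul_fromCols] at this
  simpa using this

/-- If `T ⊕ 0` is a product of three positive semidefinite matrices, then so is `T`. -/
lemma exists_posSemidef_of_fromBlocks_zero {T : Matrix l l ℂ}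
    {P₁ P₂ P₃ : Matrix (l ⊕ n) (l ⊕ n) ℂ} (h₁ : P₁.PosSemidef) (h₂ : P₂.PosSemidef)
    (h₃ : P₃.PosSemidef) (hT : fromBlocks T 0 0 0 = P₁ * P₂ * P₃) :
    ∃ Q₁ Q₂ Q₃ : Matrix l l ℂ, Q₁.PosSemidef ∧ Q₂.PosSemidef ∧ Q₃.PosSemidef ∧
      T = Q₁ * Q₂ * Q₃ := by
  obtain ⟨A₁, C₁, g₁, hA₁, rfl⟩ := h₁.exists_eq_fromBlocks
  obtain ⟨A₃, C₃, g₃, hA₃, rfl⟩ := h₃.exists_eq_fromBlocks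
  refine ⟨A₁, P₂.toBlocks₁₁, A₃, hA₁, h₂.submatrix Sum.inl, hA₃, ?_⟩
  rw [← fromBlocks_toBlocks P₂, fromBlocks_multiply, fromBlocks_multiply, fromBlocks_inj] at hT
  obtain ⟨h11, h12, h21, h22⟩ := hT
  generalize P₂.toBlocks₁₁ = X at *
  generalize P₂.toBlocks₁₂ = Y at *
  generalize P₂.toBlocks₂₁ = Z at *
  generalize P₂.toBlocks₂₂ = W at *
  calc T = A₁ * X * A₃ +
        (((A₁ + g₁ * C₁ * g₁ᴴ) * X + g₁ * C₁ * Z) * (g₃ * C₃) +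
          ((A₁ + g₁ * C₁ * g₁ᴴ) * Y + g₁ * C₁ * W) * C₃ -
          g₁ * ((C₁ * g₁ᴴ * X + C₁ * Z) * (g₃ * C₃) + (C₁ * g₁ᴴ * Y + C₁ * W) * C₃)) * g₃ᴴ +
        g₁ * ((C₁ * g₁ᴴ * X + C₁ * Z) * (A₃ + g₃ * C₃ * g₃ᴴ) +
          (C₁ * g₁ᴴ * Y + C₁ * W) * (C₃ * g₃ᴴ)) := by
        rw [h11]
        simp only [Matrix.mul_add, Matrix.add_mul, Matrix.sub_mul, Matrix.mul_assoc]
        abel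
    _ = A₁ * X * A₃ := by
        rw [← h12, ← h21, ← h22]
        simp

end NecessaryCondition

section Factorization

variable {n κ : Type*} [Fintype n] [DecidableEq n] [Fintype κ] [DecidableEq κ]

/-- `T` is the product of a positive definite matrix and a matrix that is diagonalizable with
nonnegative eigenvalues. -/
def IsPosDefMulDiagonalizable (T : Matrix n n ℂ) : Prop :=
  ∃ (P S : Matrix n n ℂ) (d : n → ℝ), P.PosDef ∧ IsUnit S ∧ (∀ i, 0 ≤ d i) ∧
    T * S = P * S * diagonal (fun i => (d i : ℂ))

namespace IsPosDefMulDiagonalizable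

lemma zero : IsPosDefMulDiagonalizable (0 : Matrix n n ℂ) :=
  ⟨1, 1, 0, PosDef.one, isUnit_one, fun _ => le_rfl, by simp⟩

lemma exists_posSemidef {T : Matrix n n ℂ} (h : IsPosDefMulDiagonalizable T) :
    ∃ P₁ P₂ P₃ : Matrix n n ℂ, P₁.PosSemidef ∧ P₂.PosSemidef ∧ P₃.PosSemidef ∧
      T = P₁ * P₂ * P₃ := by
  obtain ⟨P, S, d, hP, hS, hd, hT⟩ := h
  have hS' := (isUnit_iff_isUnit_det S).1 hS
  have hSH : Sᴴ * S⁻¹ᴴ = 1 := by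
    rw [← conjTranspose_mul, nonsing_inv_mul _ hS', conjTranspose_one]
  have hD : (diagonal (fun i => (d i : ℂ))).PosSemidef :=
    PosSemidef.diagonal fun i => by simpa using hd i
  refine ⟨P, S * Sᴴ, S⁻¹ᴴ * diagonal (fun i => (d i : ℂ)) * S⁻¹, hP.posSemidef,
    posSemidef_self_mul_conjTranspose S, hD.conjTranspose_mul_mul_same S⁻¹, ?_⟩
  calc T = T * S * S⁻¹ := by rw [Matrix.mul_assoc, mul_nonsing_inv _ hS', Matrix.mul_one]
    _ = P * S * (Sᴴ * S⁻¹ᴴ) * diagonal (fun i => (d i : ℂ)) * S⁻¹ := by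
      rw [hT, hSH, Matrix.mul_one]
    _ = _ := by simp only [Matrix.mul_assoc]

lemma of_congruence {T G : Matrix n n ℂ} (hG : IsUnit G)
    (h : IsPosDefMulDiagonalizable (Gᴴ * T * G)) : IsPosDefMulDiagonalizable T := by
  obtain ⟨P, S, d, hP, hS, hd, hT⟩ := h
  have hG' := (isUnit_iff_isUnit_det G).1 hG
  have hGH : G⁻¹ᴴ * Gᴴ = 1 := by
    rw [← conjTranspose_mul, mul_nonsing_inv _ hG', conjTranspose_one]
  refine ⟨G⁻¹ᴴ * P * G⁻¹, G * S, d, hP.conjTranspose_mul_mul_same (mulVec_injective_of_isUnit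
    (isUnit_nonsing_inv_iff.2 hG)), hG.mul hS, hd, ?_⟩
  calc T * (G * S) = G⁻¹ᴴ * Gᴴ * T * G * S := by rw [hGH, Matrix.one_mul, Matrix.mul_assoc]
    _ = G⁻¹ᴴ * (Gᴴ * T * G * S) := by simp only [Matrix.mul_assoc]
    _ = G⁻¹ᴴ * P * (G⁻¹ * G) * S * diagonal (fun i => (d i : ℂ)) := by
      rw [hT, nonsing_inv_mul _ hG']; simp only [Matrix.mul_assoc, Matrix.one_mul]
    _ = _ := by simp only [Matrix.mul_assoc]

lemma of_submatrix {T : Matrix n n ℂ} (e : κ ≃ n)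
    (h : IsPosDefMulDiagonalizable (T.submatrix e e)) : IsPosDefMulDiagonalizable T := by
  obtain ⟨P, S, d, hP, hS, hd, hT⟩ := h
  refine ⟨P.submatrix e.symm e.symm, S.submatrix e.symm e.symm, d ∘ e.symm,
    hP.submatrix e.symm.injective, (isUnit_submatrix_equiv (A := S) e.symm e.symm).2 hS,
    fun i => hd _, ?_⟩
  have := congr_arg (fun M => M.submatrix e.symm e.symm) hT
  rw [← submatrix_mul_equiv _ _ e.symm e.symm, ← submatrix_mul_equiv _ _ e.symm e.symm,
    ← submatrix_mul_equiv _ _ e.symm e.symm, submatrix_submatrix, e.self_comp_symm,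
    submatrix_id_id, submatrix_diagonal_equiv] at this
  exact this

lemma fromBlocks {T : Matrix κ κ ℂ} (h : IsPosDefMulDiagonalizable T) (w : Matrix Unit κ ℂ) :
    IsPosDefMulDiagonalizable (fromBlocks 1 w 0 T) := by
  obtain ⟨P, S, d, hP, hS, hd, hT⟩ := h
  obtain ⟨α, hα, hαd⟩ : ∃ α : ℝ, 0 < α ∧ ∀ i, α * d i < 1 := by
    have hsum : 0 ≤ ∑ i, d i := Finset.sum_nonneg fun i _ => hd i
    refine ⟨(1 + ∑ i, d i)⁻¹, by positivity, fun i => ?_⟩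
    rw [inv_mul_lt_one₀ (by positivity)]
    linarith [Finset.single_le_sum (fun i _ => hd i) (Finset.mem_univ i)]
  set v : Matrix Unit κ ℂ := of fun i j => (w * S) i j / (α * d j - 1)
  have hv : v + w * S = (α : ℂ) • (v * diagonal (fun i => (d i : ℂ))) := by
    ext i j
    have : (α * d j - 1 : ℂ) ≠ 0 := by
      exact_mod_cast (sub_neg.2 (hαd j)).ne
    simp only [add_apply, smul_apply, mul_diagonal, v, of_apply, smul_eq_mul]
    field_simp
    ring
  have hα' : IsUnit (diagonal fun _ => (α : ℂ) : Matrix Unit Unit ℂ) := by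
    simp [isUnit_iff_isUnit_det, hα.ne']
  have hα'' : (diagonal fun _ => (α : ℂ) : Matrix Unit Unit ℂ).PosDef :=
    PosDef.diagonal fun _ => by simpa using hα
  refine ⟨Matrix.fromBlocks (diagonal fun _ => (α : ℂ)) 0 0 P, Matrix.fromBlocks 1 v 0 S,
    Sum.elim (fun _ => α⁻¹) d, ?_, isUnit_fromBlocks_zero₂₁.2 ⟨isUnit_one, hS⟩, ?_, ?_⟩
  · have := hα''.isUnit.invertible
    refine (PosSemidef.posDef_iff_isUnit ?_).2 (isUnit_fromBlocks_zero₂₁.2 ⟨hα', hP.isUnit⟩)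
    have := (PosDef.fromBlocks₁₁ (0 : Matrix Unit κ ℂ) P hα'').2 (by simpa using hP.posSemidef)
    simpa using this
  · rintro (i | i)
    · exact (inv_pos.2 hα).le
    · exact hd i
  · have hdiag : diagonal (fun i => ((Sum.elim (fun _ : Unit => α⁻¹) d i : ℝ) : ℂ)) =
        Matrix.fromBlocks (diagonal fun _ => (α : ℂ)⁻¹) 0 0 (diagonal fun i => (d i : ℂ)) := by
      rw [fromBlocks_diagonal]
      congr 1
      ext (i | i) <;> simp
    have hαC : (α : ℂ) ≠ 0 := by exact_mod_cast hα.ne'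
    rw [hdiag]
    simp only [fromBlocks_multiply, fromBlocks_inj, Matrix.one_mul, Matrix.mul_one,
      Matrix.mul_zero, Matrix.zero_mul, add_zero, zero_add]
    refine ⟨?_, ?_, trivial, hT⟩
    · simp [hαC]
    · rw [hv, ← smul_one_eq_diagonal, smul_mul, smul_mul, Matrix.one_mul]

end IsPosDefMulDiagonalizable

omit [DecidableEq n] in
/-- If some vector is annihilated by `T` but not by `Tᴴ`, then there is a vector `s` with
`sᴴ T s = 1` which either preserves this property on passing to the complement of `s`, or witnesses
that `T` has rank one. -/
lemma exists_dotProduct_mulVec_eq_one {T : Matrix n n ℂ} {x : n → ℂ} (hx : T *ᵥ x = 0)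
    (hx' : star x ᵥ* T ≠ 0) :
    ∃ s : n → ℂ, star s ⬝ᵥ T *ᵥ s = 1 ∧ ((∀ z : n → ℂ, ∃ c : ℂ, star z ᵥ* T = c • (star s ᵥ* T)) ∨
      ∀ c : ℂ, star x ᵥ* T ≠ c • (star s ᵥ* T)) := by
  set r := star x ᵥ* T with hr
  have exists_shift (y : n → ℂ) (hy : r ⬝ᵥ y ≠ 0) :
      ∃ (t : ℂ) (s : n → ℂ), star s ⬝ᵥ T *ᵥ s = 1 ∧ star s ᵥ* T = star y ᵥ* T + t • r := by
    set t := (1 - star y ⬝ᵥ T *ᵥ y) / (r ⬝ᵥ y)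
    have hs : star (y + star t • x) ᵥ* T = star y ᵥ* T + t • r := by
      simp [add_vecMul, smul_vecMul, hr]
    refine ⟨t, y + star t • x, ?_, hs⟩
    rw [mulVec_add, mulVec_smul, hx, smul_zero, add_zero, dotProduct_mulVec, hs, add_dotProduct,
      smul_dotProduct, ← dotProduct_mulVec, smul_eq_mul, div_mul_cancel₀ _ hy]
    ring
  by_cases hA : ∃ y : n → ℂ, r ⬝ᵥ y ≠ 0 ∧ ∀ c : ℂ, star y ᵥ* T ≠ c • r
  · obtain ⟨y, hy, hyr⟩ := hA
    obtain ⟨t, s, hs, hsT⟩ := exists_shift y hy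
    refine ⟨s, hs, Or.inr fun c hc => ?_⟩
    have hc0 : c ≠ 0 := by
      rintro rfl
      exact hx' (by simpa using hc)
    refine hyr (c⁻¹ - t) ?_
    rw [sub_smul, eq_sub_iff_add_eq, ← hsT, eq_inv_smul_iff₀ hc0, ← hc]
  · push Not at hA
    have hy : r ⬝ᵥ star r ≠ 0 := by simpa using hx'
    obtain ⟨t, s, hs, hsT⟩ := exists_shift (star r) hy
    have hrow (z : n → ℂ) : ∃ c : ℂ, star z ᵥ* T = c • r := by
      by_cases hz : r ⬝ᵥ z = 0
      · obtain ⟨c₁, hc₁⟩ := hA (z + star r) (by rwa [dotProduct_add, hz, zero_add])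
        obtain ⟨c₂, hc₂⟩ := hA (star r) hy
        refine ⟨c₁ - c₂, ?_⟩
        rw [sub_smul, ← hc₁, ← hc₂, star_add, add_vecMul, add_sub_cancel_right]
      · exact hA z hz
    refine ⟨s, hs, Or.inl fun z => ?_⟩
    obtain ⟨c, hc⟩ := hrow z
    obtain ⟨a, ha⟩ := hrow s
    have ha0 : a ≠ 0 := by
      rintro rfl
      rw [dotProduct_mulVec, ha] at hs
      simp at hs
    exact ⟨c / a, by rw [hc, ha, smul_smul, div_mul_cancel₀ _ ha0]⟩

/-- A vector `s` with `sᴴ T s = 1` splits off under congruence. -/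
lemma exists_congruence_fromBlocks {T : Matrix (Unit ⊕ κ) (Unit ⊕ κ) ℂ} {s : Unit ⊕ κ → ℂ}
    (hs : star s ⬝ᵥ T *ᵥ s = 1) :
    ∃ (S : Matrix (Unit ⊕ κ) (Unit ⊕ κ) ℂ) (w : Matrix Unit κ ℂ) (T' : Matrix κ κ ℂ), IsUnit S ∧
      S *ᵥ Sum.elim 1 0 = s ∧ Sᴴ * T * S = fromBlocks 1 w 0 T' := by
  have he : (Sum.elim 1 0 : Unit ⊕ κ → ℂ) ≠ 0 := fun h => by
    simpa using congr_fun h (Sum.inl ())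
  have hs0 : s ≠ 0 := by
    rintro rfl
    simp at hs
  obtain ⟨A, hA⟩ := SeparatingDual.exists_continuousLinearEquiv_apply_eq (R := ℂ) he hs0
  set G : Matrix (Unit ⊕ κ) (Unit ⊕ κ) ℂ := LinearMap.toMatrix' A.toLinearEquiv.toLinearMap
  have hGs : G *ᵥ Sum.elim 1 0 = s := by
    rw [LinearMap.toMatrix'_mulVec]
    exact hA
  have hG : IsUnit G := by
    rw [← mulVec_injective_iff_isUnit]
    intro u v huv
    simp only [G, LinearMap.toMatrix'_mulVec] at huv
    exact A.injective huv
  obtain ⟨a, b, c, d, hblocks⟩ : ∃ a b c d, Gᴴ * T * G = fromBlocks a b c d :=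
    ⟨_, _, _, _, (fromBlocks_toBlocks _).symm⟩
  have ha : a = 1 := by
    have h : star (Sum.elim 1 0 : Unit ⊕ κ → ℂ) ⬝ᵥ (Gᴴ * T * G) *ᵥ Sum.elim 1 0 = 1 := by
      rw [← mulVec_mulVec, ← mulVec_mulVec, hGs, dotProduct_mulVec, ← star_mulVec, hGs, hs]
    ext i j
    simpa [hblocks, fromBlocks_mulVec, dotProduct, mulVec] using h
  subst ha
  have hL : IsUnit (fromBlocks 1 (-cᴴ) 0 1 : Matrix (Unit ⊕ κ) (Unit ⊕ κ) ℂ) :=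
    isUnit_fromBlocks_zero₂₁.2 ⟨isUnit_one, isUnit_one⟩
  refine ⟨G * fromBlocks 1 (-cᴴ) 0 1, b - cᴴ, d - c * b, hG.mul hL, ?_, ?_⟩
  · rw [← mulVec_mulVec, fromBlocks_mulVec]
    simpa using hGs
  · calc (G * fromBlocks 1 (-cᴴ) 0 1)ᴴ * T * (G * fromBlocks 1 (-cᴴ) 0 1)
        = (fromBlocks 1 (-cᴴ) 0 1)ᴴ * (Gᴴ * T * G) * fromBlocks 1 (-cᴴ) 0 1 := by
          rw [conjTranspose_mul]; simp only [Matrix.mul_assoc]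
      _ = _ := by
        rw [hblocks, fromBlocks_conjTranspose, fromBlocks_multiply, fromBlocks_multiply]
        simp [sub_eq_add_neg, add_comm]

lemma isPosDefMulDiagonalizable_sum
    (ih : ∀ (T : Matrix κ κ ℂ) (x : κ → ℂ), T *ᵥ x = 0 → star x ᵥ* T ≠ 0 →
      IsPosDefMulDiagonalizable T)
    {T : Matrix (Unit ⊕ κ) (Unit ⊕ κ) ℂ} {x : Unit ⊕ κ → ℂ} (hx : T *ᵥ x = 0)
    (hx' : star x ᵥ* T ≠ 0) : IsPosDefMulDiagonalizable T := by
  obtain ⟨s, hs, hsT⟩ := exists_dotProduct_mulVec_eq_one hx hx'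
  obtain ⟨S, w, T', hS, hSs, hST⟩ := exists_congruence_fromBlocks hs
  have hrow (u : Unit ⊕ κ → ℂ) : (star (S *ᵥ u) ᵥ* T) ᵥ* S = star u ᵥ* fromBlocks 1 w 0 T' := by
    rw [← hST, star_mulVec, vecMul_vecMul, vecMul_vecMul, Matrix.mul_assoc]
  have hrow_s : (star s ᵥ* T) ᵥ* S = Sum.elim (1 : Unit → ℂ) (w ()) := by
    rw [← hSs, hrow]
    ext (i | i) <;> simp [vecMul, dotProduct]
  refine .of_congruence hS ?_
  rw [hST]
  refine .fromBlocks ?_ w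
  rcases hsT with hsT | hsT
  · suffices h : T' = 0 from h ▸ .zero
    ext i j
    obtain ⟨c, hc⟩ := hsT (S *ᵥ Sum.elim 0 (Pi.single i 1))
    have h := congr_arg (· ᵥ* S) hc
    simp only [hrow, smul_vecMul, hrow_s] at h
    have hc0 : c = 0 := by
      simpa [vecMul, dotProduct] using (congr_fun h (Sum.inl ())).symm
    simpa [hc0, vecMul, dotProduct, Pi.single_apply, apply_ite] using congr_fun h (Sum.inr j)
  · obtain ⟨ξ, rfl⟩ : ∃ ξ, S *ᵥ ξ = x :=
      ⟨S⁻¹ *ᵥ x, by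
        rw [mulVec_mulVec, mul_nonsing_inv _ ((isUnit_iff_isUnit_det S).1 hS), one_mulVec]⟩
    refine ih T' (ξ ∘ Sum.inr) ?_ fun h => ?_
    · have h : fromBlocks 1 w 0 T' *ᵥ ξ = 0 := by
        rw [← hST, ← mulVec_mulVec, ← mulVec_mulVec, hx, mulVec_zero]
      rw [fromBlocks_mulVec] at h
      simpa using congr_arg (· ∘ Sum.inr) h
    · refine hsT (star (ξ (Sum.inl ()))) (vecMul_injective_of_isUnit hS ?_)
      simp only [hrow, smul_vecMul, hrow_s]
      rw [vecMul_fromBlocks]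
      have h' : (star ξ ∘ Sum.inr) ᵥ* T' = 0 := h
      rw [h']
      ext (i | i) <;> simp [vecMul, dotProduct]

/-- A matrix whose kernel is not contained in the kernel of its adjoint is the product of a positive
definite matrix and a matrix that is diagonalizable with nonnegative eigenvalues. -/
theorem isPosDefMulDiagonalizable_of_mulVec_eq_zero {T : Matrix n n ℂ} {x : n → ℂ}
    (hx : T *ᵥ x = 0) (hx' : star x ᵥ* T ≠ 0) : IsPosDefMulDiagonalizable T := by
  have fin (k : ℕ) : ∀ (T : Matrix (Fin k) (Fin k) ℂ) (x : Fin k → ℂ), T *ᵥ x = 0 →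
      star x ᵥ* T ≠ 0 → IsPosDefMulDiagonalizable T := by
    induction k with
    | zero => exact fun T x _ h => (h (Subsingleton.elim _ _)).elim
    | succ k ih =>
      intro T x hx hx'
      have e : Unit ⊕ Fin k ≃ Fin (k + 1) := Fintype.equivOfCardEq (by simp [add_comm])
      refine .of_submatrix e (isPosDefMulDiagonalizable_sum ih (x := x ∘ e) ?_ fun h => hx' ?_)
      · rw [submatrix_mulVec_equiv]
        simp [Function.comp_assoc, hx]
      · have h' : star (x ∘ e) = star x ∘ e := rfl
        rw [h', submatrix_vecMul_equiv] at h
        simp only [Function.comp_assoc, Equiv.self_comp_symm, Function.comp_id] at h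
        ext i
        simpa using congr_fun h (e.symm i)
  have e := Fintype.equivFin n
  refine .of_submatrix e.symm (fin _ _ (x ∘ e.symm) ?_ fun h => hx' ?_)
  · rw [submatrix_mulVec_equiv]
    simp [Function.comp_assoc, hx]
  · have h' : star (x ∘ e.symm) = star x ∘ e.symm := rfl
    rw [h', submatrix_vecMul_equiv] at h
    simp only [Function.comp_assoc, Equiv.symm_comp_self, Equiv.symm_symm, Function.comp_id] at h
    ext i
    simpa using congr_fun h (e i)

end Factorization

section InvertibleNilpotent

variable {l n : Type*} [Fintype l] [Fintype n] [DecidableEq l] [DecidableEq n]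

/-- A nilpotent matrix whose kernel is contained in the kernel of its adjoint vanishes. -/
lemma eq_zero_of_isNilpotent_of_forall {N : Matrix n n ℂ} (hN : IsNilpotent N)
    (h : ∀ v : n → ℂ, N *ᵥ v = 0 → star v ᵥ* N = 0) : N = 0 := by
  by_contra hN0
  obtain ⟨k, hk⟩ := hN
  have hex : ∃ k, N ^ (k + 1) = 0 := ⟨k, by rw [pow_succ, hk, Matrix.zero_mul]⟩
  classical
  obtain ⟨j, hj, hmin⟩ : ∃ j, N ^ (j + 1) = 0 ∧ ∀ i < j, N ^ (i + 1) ≠ 0 :=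
    ⟨Nat.find hex, Nat.find_spec hex, fun i hi => Nat.find_min hex hi⟩
  cases j with
  | zero => exact hN0 (by simpa using hj)
  | succ j =>
    have hM : (N ^ (j + 1))ᴴ * N = 0 := by
      ext i k
      have hv : N *ᵥ (N ^ (j + 1)).col i = 0 := by
        ext a
        simpa [pow_succ', mul_apply, mulVec, dotProduct] using congr_fun₂ hj a i
      exact congr_fun (h _ hv) k
    refine hmin j (Nat.lt_succ_self j) (conjTranspose_mul_self_eq_zero.1 ?_)
    calc (N ^ (j + 1))ᴴ * N ^ (j + 1) = (N ^ (j + 1))ᴴ * N * N ^ j := by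
          rw [pow_succ', Matrix.mul_assoc]
      _ = 0 := by rw [hM, Matrix.zero_mul]

/-- If the kernel of `T₁ ⊕ T₂` with corner `R` is contained in the kernel of the adjoint, where `T₁`
is invertible and `T₂` nilpotent, then `R` and `T₂` vanish. -/
lemma eq_zero_of_fromBlocks_of_forall {T₁ : Matrix l l ℂ} {R : Matrix l n ℂ} {T₂ : Matrix n n ℂ}
    (hT₁ : IsUnit T₁) (hT₂ : IsNilpotent T₂)
    (h : ∀ x : l ⊕ n → ℂ, fromBlocks T₁ R 0 T₂ *ᵥ x = 0 → star x ᵥ* fromBlocks T₁ R 0 T₂ = 0) :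
    R = 0 ∧ T₂ = 0 := by
  have hker (v : n → ℂ) (hv : T₂ *ᵥ v = 0) : R *ᵥ v = 0 ∧ star v ᵥ* T₂ = 0 := by
    have hcancel : T₁ *ᵥ (T₁⁻¹ *ᵥ (R *ᵥ v)) = R *ᵥ v := by
      rw [mulVec_mulVec, mul_nonsing_inv _ ((isUnit_iff_isUnit_det T₁).1 hT₁), one_mulVec]
    set u := T₁⁻¹ *ᵥ (R *ᵥ v)
    have h0 := h (Sum.elim (-u) v) (by
      rw [fromBlocks_mulVec]
      simp [mulVec_neg, hcancel, hv])
    have hstar : star (Sum.elim (-u) v) = Sum.elim (-star u) (star v) := by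
      ext (i | i) <;> simp
    rw [hstar, vecMul_fromBlocks] at h0
    have hl : (-star u) ᵥ* T₁ = 0 := by simpa using congr_arg (· ∘ Sum.inl) h0
    have hu : -star u = 0 := vecMul_injective_of_isUnit hT₁ (by simpa using hl)
    have hr : star v ᵥ* T₂ = 0 := by simpa [hu] using congr_arg (· ∘ Sum.inr) h0
    have hu' : u = 0 := by simpa using hu
    exact ⟨by rw [← hcancel, hu', mulVec_zero], hr⟩
  have hzero : T₂ = 0 := eq_zero_of_isNilpotent_of_forall hT₂ fun v hv => (hker v hv).2
  refine ⟨?_, hzero⟩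
  ext i j
  simpa using congr_fun (hker (Pi.single j 1) (by rw [hzero, zero_mulVec])).1 i

end InvertibleNilpotent

end Matrix

theorem product_of_three_psd_iff (m p : ℕ) (hm : 1 ≤ m) (hp : 1 ≤ p)
    (T1 : Matrix (Fin m) (Fin m) ℂ) (R : Matrix (Fin m) (Fin p) ℂ)
    (T2 : Matrix (Fin p) (Fin p) ℂ)
    (hT1 : IsUnit T1) (hT2 : IsNilpotent T2) :
    (∃ P1 P2 P3 : Matrix (Fin m ⊕ Fin p) (Fin m ⊕ Fin p) ℂ,
      P1.PosSemidef ∧ P2.PosSemidef ∧ P3.PosSemidef ∧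
      Matrix.fromBlocks T1 R 0 T2 = P1 * P2 * P3) ↔
    ((R ≠ 0 ∨ T2 ≠ 0) ∨
      (R = 0 ∧ T2 = 0 ∧
        ∃ Q1 Q2 Q3 : Matrix (Fin m) (Fin m) ℂ,
          Q1.PosDef ∧ Q2.PosDef ∧ Q3.PosDef ∧ T1 = Q1 * Q2 * Q3)) := by
  constructor
  · rintro ⟨P1, P2, P3, h1, h2, h3, hT⟩
    by_cases h : R ≠ 0 ∨ T2 ≠ 0
    · exact Or.inl h
    push Not at h
    obtain ⟨rfl, rfl⟩ := h
    obtain ⟨Q1, Q2, Q3, hQ1, hQ2, hQ3, rfl⟩ :=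
      Matrix.exists_posSemidef_of_fromBlocks_zero h1 h2 h3 hT
    obtain ⟨h12, h3'⟩ := IsUnit.mul_iff.1 hT1
    obtain ⟨h1', h2'⟩ := IsUnit.mul_iff.1 h12
    exact Or.inr ⟨rfl, rfl, Q1, Q2, Q3, hQ1.posDef_iff_isUnit.2 h1', hQ2.posDef_iff_isUnit.2 h2',
      hQ3.posDef_iff_isUnit.2 h3', rfl⟩
  · rintro (h | ⟨rfl, rfl, Q1, Q2, Q3, h1, h2, h3, rfl⟩)
    · obtain ⟨x, hx, hx'⟩ : ∃ x, Matrix.fromBlocks T1 R 0 T2 *ᵥ x = 0 ∧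
          star x ᵥ* Matrix.fromBlocks T1 R 0 T2 ≠ 0 := by
        by_contra! hall
        obtain ⟨hR, hT⟩ := Matrix.eq_zero_of_fromBlocks_of_forall hT1 hT2 hall
        exact h.elim (· hR) (· hT)
      exact (Matrix.isPosDefMulDiagonalizable_of_mulVec_eq_zero hx hx').exists_posSemidef
    · exact ⟨_, _, _, h1.posSemidef.fromBlocks_zero, h2.posSemidef.fromBlocks_zero,
        h3.posSemidef.fromBlocks_zero, by simp [Matrix.fromBlocks_multiply]⟩
end

section
/- Let m, p ≥ 1 and let T be the (m+p)×(m+p) complex block matrix T = [[T1, R],[0, T2]], where T1 is an invertible m×m complex matrix and T2 is a nilpotent p×p complex matrix. If R ≠ 0 or T2 ≠ 0, then T is a product of three positive semi-definite matrices. -/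
open scoped Matrix ComplexOrder

namespace Matrix

section ResolventMatrix

variable {ι R : Type*} [Fintype ι] [DecidableEq ι] [CommRing R]

/-- The matrix whose `j`-th row is `y` times the adjugate of `μ j - N`. -/
def resolventMatrix (μ y : ι → R) (N : Matrix ι ι R) : Matrix ι ι R :=
  of fun j => y ᵥ* adjugate (μ j • 1 - N)

theorem row_resolventMatrix (μ y : ι → R) (N : Matrix ι ι R) (j : ι) :
    (resolventMatrix μ y N) j = y ᵥ* adjugate (μ j • 1 - N) := rfl

theorem resolventMatrix_map {S : Type*} [CommRing S] (f : R →+* S) (μ y : ι → R)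
    (N : Matrix ι ι R) :
    f.mapMatrix (resolventMatrix μ y N) = resolventMatrix (f ∘ μ) (f ∘ y) (f.mapMatrix N) := by
  ext i j
  have h : f.mapMatrix (μ i • (1 : Matrix ι ι R) - N) = f (μ i) • 1 - f.mapMatrix N := by
    rw [map_sub]
    congr 1
    ext k l
    by_cases hkl : k = l <;> simp [hkl]
  simp only [row_resolventMatrix, RingHom.mapMatrix_apply, map_apply, Function.comp_apply]
  rw [← RingHom.mapMatrix_apply, ← h, ← RingHom.map_adjugate, RingHom.map_vecMul]
  rfl

theorem diagonal_mul_resolventMatrix (μ y : ι → R) (N : Matrix ι ι R) :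
    diagonal μ * resolventMatrix μ y N =
      resolventMatrix μ y N * N + vecMulVec (fun j => (μ j • 1 - N).det) y := by
  ext j k
  have h : (y ᵥ* adjugate (μ j • 1 - N)) ᵥ* (μ j • 1 - N) = (μ j • 1 - N).det • y := by
    rw [vecMul_vecMul, adjugate_mul, vecMul_smul, vecMul_one]
  have hk := congrFun h k
  rw [vecMul_sub, vecMul_smul, vecMul_one] at hk
  simp only [Pi.sub_apply, Pi.smul_apply, smul_eq_mul] at hk
  rw [diagonal_mul, add_apply, mul_apply_eq_vecMul, vecMulVec_apply, row_resolventMatrix, ← hk]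
  ring

end ResolventMatrix

section Field

variable {ι K : Type*} [Fintype ι] [DecidableEq ι] [Field K]

theorem det_smul_one_sub_diagonal_sub_ne_zero {μ : ι → K} (hμ : Function.Injective μ) (j : ι) :
    (μ j • 1 - (diagonal μ - vecMulVec 1 1) : Matrix ι ι K).det ≠ 0 := by
  intro h
  obtain ⟨v, hv, h0⟩ := exists_mulVec_eq_zero_iff.mpr h
  have hk (k : ι) : (μ j - μ k) * v k + ∑ i, v i = 0 := by
    have := congrFun h0 k
    simp only [sub_mulVec, smul_mulVec, one_mulVec, mulVec_diagonal, vecMulVec_mulVec,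
      Pi.sub_apply, Pi.smul_apply, Pi.zero_apply, one_dotProduct, Pi.one_apply, smul_eq_mul,
      MulOpposite.smul_eq_mul_unop, MulOpposite.unop_op, one_mul] at this
    linear_combination this
  have hs : ∑ i, v i = 0 := by simpa using hk j
  have hne (k : ι) (hkj : k ≠ j) : v k = 0 := by
    have := hk k
    rw [hs, add_zero, mul_eq_zero, sub_eq_zero] at this
    exact this.resolve_left fun e => hkj (hμ e).symm
  refine hv (funext fun k => ?_)
  by_cases hkj : k = j
  · rw [Fintype.sum_eq_single j hne] at hs
    simpa [hkj] using hs
  · exact hne k hkj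

theorem exists_isUnit_vecMul_eq {x y : ι → K} (hx : x ≠ 0) (hy : y ≠ 0) :
    ∃ A : Matrix ι ι K, IsUnit A ∧ x ᵥ* A = y := by
  let f := (LinearEquiv.toSpanNonzeroSingleton K _ x hx).symm ≪≫ₗ
    LinearEquiv.toSpanNonzeroSingleton K _ y hy
  obtain ⟨g, hg⟩ := Submodule.exists_linearEquiv_restrict_eq f
  refine ⟨(LinearMap.toMatrix' g.toLinearMap)ᵀ, ?_, ?_⟩
  · rw [isUnit_transpose, LinearMap.isUnit_toMatrix'_iff]
    exact (Module.End.isUnit_iff _).mpr g.bijective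
  · rw [vecMul_transpose, LinearMap.toMatrix'_mulVec]
    have h1 : (LinearEquiv.toSpanNonzeroSingleton K _ x hx).symm
        ⟨x, Submodule.mem_span_singleton_self x⟩ = 1 := by
      rw [LinearEquiv.symm_apply_eq, LinearEquiv.toSpanNonzeroSingleton_one]
    have h2 := hg ⟨x, Submodule.mem_span_singleton_self x⟩
    simpa [f, h1] using h2.symm

theorem exists_det_resolventMatrix_ne_zero {μ y : ι → K} (hμ : Function.Injective μ)
    (hy : y ≠ 0) : ∃ N : Matrix ι ι K, (resolventMatrix μ y N).det ≠ 0 := by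
  have h1 : (1 : ι → K) ≠ 0 := by
    obtain ⟨i, -⟩ := Function.ne_iff.mp hy
    exact fun h => one_ne_zero (congrFun h i)
  obtain ⟨W, hW, hWy⟩ := exists_isUnit_vecMul_eq h1 hy
  have hWd : IsUnit W.det := (isUnit_iff_isUnit_det W).mp hW
  set N₁ : Matrix ι ι K := diagonal μ - vecMulVec 1 1
  set N : Matrix ι ι K := W⁻¹ * N₁ * W with hN
  have hdet (j : ι) : (μ j • 1 - N).det ≠ 0 := by
    have : μ j • 1 - N = W⁻¹ * (μ j • 1 - N₁) * W := by
      rw [mul_sub, sub_mul, hN, mul_smul_comm, mul_one, smul_mul_assoc, nonsing_inv_mul _ hWd]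
    rw [this, det_conj' hW]
    exact det_smul_one_sub_diagonal_sub_ne_zero hμ j
  have hWN : W * N = diagonal μ * W - vecMulVec 1 y := by
    rw [hN, ← mul_assoc, ← mul_assoc, mul_nonsing_inv _ hWd, one_mul, sub_mul, vecMulVec_mul, hWy]
  have hrow (j : ι) : y ᵥ* adjugate (μ j • 1 - N) = (μ j • 1 - N).det • W j := by
    have h2 : W j ᵥ* (μ j • 1 - N) = y := by
      have h3 := congrFun hWN j
      rw [vecMul_sub, vecMul_smul, vecMul_one]
      ext k
      have h4 := congrFun h3 k
      rw [mul_apply_eq_vecMul, sub_apply, diagonal_mul, vecMulVec_apply] at h4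
      simp only [Pi.sub_apply, Pi.smul_apply, smul_eq_mul, h4, Pi.one_apply]
      ring
    conv_lhs => rw [← h2]
    rw [vecMul_vecMul, mul_adjugate, vecMul_smul, vecMul_one]
  refine ⟨N, ?_⟩
  have : resolventMatrix μ y N = diagonal (fun j => (μ j • 1 - N).det) * W := by
    ext j k
    rw [row_resolventMatrix, hrow, diagonal_mul, Pi.smul_apply, smul_eq_mul]
  rw [this, det_mul, det_diagonal]
  exact mul_ne_zero (Finset.prod_ne_zero_iff.mpr fun j _ => hdet j) hWd.ne_zero

theorem exists_polynomial_eval_eq_det_resolventMatrix (μ y : ι → K) (A B : Matrix ι ι K) :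
    ∃ p : Polynomial K, ∀ t, p.eval t = (resolventMatrix μ y (A + t • B)).det := by
  refine ⟨(resolventMatrix (Polynomial.C ∘ μ) (Polynomial.C ∘ y)
    (A.map Polynomial.C + (Polynomial.X : Polynomial K) • B.map Polynomial.C)).det, fun t => ?_⟩
  rw [← Polynomial.coe_evalRingHom, RingHom.map_det, resolventMatrix_map]
  congr 2
  · ext; simp
  · ext; simp
  · ext
    simp only [RingHom.mapMatrix_apply, map_apply, add_apply, smul_apply, smul_eq_mul,
      Polynomial.coe_evalRingHom, Polynomial.eval_add, Polynomial.eval_mul, Polynomial.eval_X,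
      Polynomial.eval_C]

/-- A rank factorization of a square matrix. -/
theorem exists_rank_factorization (T : Matrix ι ι K) :
    ∃ (r : ℕ) (U : Matrix ι (Fin r) K) (V : Matrix (Fin r) ι K) (U' : Matrix (Fin r) ι K)
      (V' : Matrix ι (Fin r) K), T = U * V ∧ U' * U = 1 ∧ V * V' = 1 := by
  obtain ⟨P, Q, e, hP, hQ, h⟩ := T.exists_rank_normal_form
  rw [isUnit_iff_isUnit_det] at hP hQ
  set E : Matrix ι (Fin T.rank) K := (fromRows 1 0).submatrix e id
  set F : Matrix (Fin T.rank) ι K := (fromCols 1 0).submatrix id e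
  have hFE : F * E = 1 := by
    rw [submatrix_mul_equiv, fromCols_mul_fromRows]
    simp
  have hEF : E * F = (fromBlocks 1 0 0 0).submatrix e e := by
    rw [← submatrix_mul _ _ _ _ _ Function.bijective_id, fromRows_mul_fromCols]
    simp
  refine ⟨T.rank, P⁻¹ * E, F * Q⁻¹, F * P, Q * E, ?_, ?_, ?_⟩
  · calc T = P⁻¹ * (P * T * Q) * Q⁻¹ := by
          rw [mul_assoc P, nonsing_inv_mul_cancel_left _ _ hP, mul_nonsing_inv_cancel_right _ _ hQ]
      _ = P⁻¹ * E * (F * Q⁻¹) := by rw [h, ← hEF]; simp only [Matrix.mul_assoc]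
  · rw [Matrix.mul_assoc, mul_nonsing_inv_cancel_left _ _ hP, hFE]
  · rw [Matrix.mul_assoc, nonsing_inv_mul_cancel_left _ _ hQ, hFE]

end Field

section Complex

variable {ι n : Type*} [Fintype ι] [DecidableEq ι] [Fintype n] [DecidableEq n]

open scoped MatrixOrder Matrix.Norms.L2Operator in
theorem IsHermitian.posDef_add_smul_one {H : Matrix n n ℂ} (hH : H.IsHermitian) {s : ℝ}
    (hs : ‖H‖ < s) : (H + (s : ℂ) • 1).PosDef := by
  have h1 : (H + (‖H‖ : ℂ) • 1).PosSemidef := by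
    have h := IsSelfAdjoint.neg_algebraMap_norm_le_self (a := H) hH
    rw [le_iff] at h
    have e : H + (‖H‖ : ℂ) • 1 = H - -(algebraMap ℝ (Matrix n n ℂ) ‖H‖) := by
      rw [sub_neg_eq_add, Algebra.algebraMap_eq_smul_one]
      rfl
    rw [e]
    exact h
  have h2 : (((s - ‖H‖ : ℝ) : ℂ) • (1 : Matrix n n ℂ)).PosDef :=
    PosDef.one.smul (by exact_mod_cast sub_pos.mpr hs)
  convert h2.posSemidef_add h1 using 1
  push_cast
  module

theorem exists_posDef_det_resolventMatrix_ne_zero {μ y : ι → ℂ} (hμ : Function.Injective μ)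
    (hy : y ≠ 0) {U : Matrix n ι ℂ} {V U' : Matrix ι n ℂ} {V' : Matrix n ι ℂ}
    (hU : U' * U = 1) (hV : V * V' = 1) :
    ∃ C : Matrix n n ℂ, C.PosDef ∧ (resolventMatrix μ y (V * C * U)).det ≠ 0 := by
  obtain ⟨N, hN⟩ := exists_det_resolventMatrix_ne_zero hμ hy
  set G : Matrix n n ℂ := V' * N * U'
  have hG : V * G * U = N := by
    calc V * G * U = (V * V') * N * (U' * U) := by simp only [G, Matrix.mul_assoc]
      _ = N := by rw [hU, hV, Matrix.one_mul, Matrix.mul_one]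
  obtain ⟨A, B, hA, hB, hAB⟩ : ∃ A B : Matrix n n ℂ, A.IsHermitian ∧ B.IsHermitian ∧
      G = A + Complex.I • B :=
    ⟨realPart G, imaginaryPart G, (realPart G).2, (imaginaryPart G).2,
      (realPart_add_I_smul_imaginaryPart G).symm⟩
  obtain ⟨p, hp⟩ := exists_polynomial_eval_eq_det_resolventMatrix μ y (V * A * U) (V * B * U)
  have hp0 : p ≠ 0 := by
    rintro rfl
    apply hN
    rw [← hG, hAB, Matrix.mul_add, Matrix.add_mul, Matrix.mul_smul, Matrix.smul_mul, ← hp]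
    simp
  have hfin (q : Polynomial ℂ) (hq : q ≠ 0) : {s : ℝ | q.eval (s : ℂ) = 0}.Finite :=
    (Polynomial.finite_setOfPred_isRoot hq).preimage Complex.ofReal_injective.injOn
  obtain ⟨t, ht⟩ := (hfin p hp0).infinite_compl.nonempty
  have hH : (A + (t : ℂ) • B).IsHermitian := hA.add (hB.smul (by simp [IsSelfAdjoint]))
  set H := A + (t : ℂ) • B with hHdef
  obtain ⟨q, hq⟩ := exists_polynomial_eval_eq_det_resolventMatrix μ y (V * H * U) (V * U)
  have hq0 : q ≠ 0 := by
    rintro rfl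
    apply ht
    have := hq 0
    rw [zero_smul, add_zero, hHdef, Matrix.mul_add, Matrix.add_mul, Matrix.mul_smul,
      Matrix.smul_mul, ← hp] at this
    simpa using this.symm
  obtain ⟨c, hc⟩ : ∃ c : ℝ, ∀ s : ℝ, c < s → (H + (s : ℂ) • 1).PosDef :=
    ⟨_, fun _ => hH.posDef_add_smul_one⟩
  obtain ⟨s, hs, hcs⟩ := ((Set.Ioi_infinite c).sdiff (hfin q hq0)).nonempty
  refine ⟨H + (s : ℂ) • 1, hc s hs, ?_⟩
  rw [Matrix.mul_add, Matrix.add_mul, Matrix.mul_smul, Matrix.smul_mul, Matrix.mul_one, ← hq]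
  exact hcs

theorem PosDef.congr_add_vecMulVec {C : Matrix n n ℂ} (hC : C.PosDef) (a g : n → ℂ) :
    ((1 + vecMulVec g (star a))ᴴ * C * (1 + vecMulVec g (star a)) +
      vecMulVec a (star a)).PosDef := by
  have h1 := hC.posSemidef.conjTranspose_mul_mul_same (1 + vecMulVec g (star a))
  have h2 := posSemidef_vecMulVec_self_star a
  refine .of_dotProduct_mulVec_pos (h1.add h2).1 fun x hx => ?_
  rw [add_mulVec, dotProduct_add]
  by_cases hax : star a ⬝ᵥ x = 0
  · refine add_pos_of_pos_of_nonneg ?_ (h2.dotProduct_mulVec_nonneg x)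
    have hSx : (1 + vecMulVec g (star a)) *ᵥ x = x := by
      rw [add_mulVec, one_mulVec, vecMulVec_mulVec, hax]
      simp
    have := hC.dotProduct_mulVec_pos hx
    rwa [← mulVec_mulVec, hSx, ← mulVec_mulVec, dotProduct_mulVec, ← star_mulVec, hSx]
  · refine add_pos_of_nonneg_of_pos (h1.dotProduct_mulVec_nonneg x) ?_
    refine lt_of_le_of_ne (h2.dotProduct_mulVec_nonneg x) fun h => hax ?_
    have h3 := congrArg (star a ⬝ᵥ ·) ((h2.dotProduct_mulVec_zero_iff x).mp h.symm)
    simp only [vecMulVec_mulVec, dotProduct_smul, dotProduct_zero] at h3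
    rcases mul_eq_zero.mp h3 with h4 | h4
    · rw [dotProduct_star_self_eq_zero.mp h4]
      simp
    · simpa using h4

/-- A square matrix whose kernel is not contained in the kernel of its adjoint is a product of
three positive semidefinite matrices. -/
theorem exists_posSemidef_mul_mul_of_mulVec_eq_zero {T : Matrix n n ℂ} {a : n → ℂ}
    (ha : T *ᵥ a = 0) (ha' : Tᴴ *ᵥ a ≠ 0) :
    ∃ P₁ P₂ P₃ : Matrix n n ℂ,
      P₁.PosSemidef ∧ P₂.PosSemidef ∧ P₃.PosSemidef ∧ T = P₁ * P₂ * P₃ := by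
  obtain ⟨r, U, V, U', V', hT, hU, hV⟩ := T.exists_rank_factorization
  have hVa : V *ᵥ a = 0 := by
    have := congrArg (U' *ᵥ ·) ha
    simpa [hT, mulVec_mulVec, ← Matrix.mul_assoc, hU] using this
  set y : Fin r → ℂ := star a ᵥ* U with hy
  have hy0 : y ≠ 0 := by
    intro h
    apply ha'
    rw [hT, conjTranspose_mul, ← mulVec_mulVec]
    have : Uᴴ *ᵥ a = star y := by rw [hy, star_vecMul, star_star]
    rw [this, h, star_zero, mulVec_zero]
  set μ : Fin r → ℂ := fun j => (j : ℂ) + 1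
  have hμ : Function.Injective μ := fun i j hij => by simpa [μ, Fin.ext_iff] using hij
  have hμpos (j : Fin r) : 0 < μ j := by
    have : (0 : ℝ) < j + 1 := by positivity
    simp only [μ]
    exact_mod_cast this
  obtain ⟨C₀, hC₀, hW⟩ := exists_posDef_det_resolventMatrix_ne_zero hμ hy0 hU hV
  have hrel := diagonal_mul_resolventMatrix μ y (V * C₀ * U)
  set W := resolventMatrix μ y (V * C₀ * U)
  set δ : Fin r → ℂ := fun j => (μ j • 1 - V * C₀ * U).det
  set g : n → ℂ := C₀⁻¹ *ᵥ V' *ᵥ W⁻¹ *ᵥ δ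
  have hWu : IsUnit W.det := isUnit_iff_ne_zero.mpr hW
  have hC₀u : IsUnit C₀.det := (isUnit_iff_isUnit_det _).mp hC₀.isUnit
  have hC := hC₀.congr_add_vecMulVec a g
  set C := (1 + vecMulVec g (star a))ᴴ * C₀ * (1 + vecMulVec g (star a)) + vecMulVec a (star a)
    with hCdef
  have hCu : IsUnit C.det := (isUnit_iff_isUnit_det _).mp hC.isUnit
  have hg : V *ᵥ C₀ *ᵥ g = W⁻¹ *ᵥ δ := by
    simp only [g, mulVec_mulVec, ← Matrix.mul_assoc]
    rw [mul_nonsing_inv_cancel_right _ _ hC₀u, hV, Matrix.one_mul]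
  clear_value g
  have hVC : V * C * U = V * C₀ * U + vecMulVec (W⁻¹ *ᵥ δ) y := by
    have h1 : V * (1 + vecMulVec g (star a))ᴴ = V := by
      rw [conjTranspose_add, conjTranspose_one, conjTranspose_vecMulVec, star_star,
        Matrix.mul_add, mul_vecMulVec, hVa, zero_vecMulVec, Matrix.mul_one, add_zero]
    rw [hCdef, Matrix.mul_add, mul_vecMulVec, hVa, zero_vecMulVec, add_zero, ← Matrix.mul_assoc,
      ← Matrix.mul_assoc, h1, Matrix.mul_add, Matrix.mul_one, mul_vecMulVec, Matrix.add_mul,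
      vecMulVec_mul, ← hg, mulVec_mulVec]
  have hWVC : W * (V * C * U) = diagonal μ * W := by
    rw [hVC, Matrix.mul_add, mul_vecMulVec, mulVec_mulVec, mul_nonsing_inv _ hWu, one_mulVec, hrel]
  have hVCU : V * C * U = W⁻¹ * diagonal μ * W := by
    rw [Matrix.mul_assoc W⁻¹, ← hWVC, nonsing_inv_mul_cancel_left _ _ hWu]
  have hUCV : Uᴴ * C * Vᴴ = Wᴴ * diagonal μ * (W⁻¹)ᴴ := by
    have hμs : star μ = μ := funext fun j => (IsSelfAdjoint.of_nonneg (hμpos j).le).star_eq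
    have := congrArg conjTranspose hVCU
    simpa [conjTranspose_mul, hC.isHermitian.eq, diagonal_conjTranspose, hμs,
      Matrix.mul_assoc] using this
  have hD : (diagonal μ).PosDef := .diagonal hμpos
  have hDu : IsUnit (diagonal μ).det := (isUnit_iff_isUnit_det _).mp hD.isUnit
  have hWW : (W⁻¹)ᴴ * Wᴴ = 1 := by
    rw [← conjTranspose_mul, mul_nonsing_inv _ hWu, conjTranspose_one]
  refine ⟨(U * W⁻¹) * (U * W⁻¹)ᴴ, (W * V * C)ᴴ * (diagonal μ)⁻¹ * (W * V * C), C⁻¹,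
    posSemidef_self_mul_conjTranspose _,
    hD.inv.posSemidef.conjTranspose_mul_mul_same _, hC.inv.posSemidef, ?_⟩
  symm
  calc (U * W⁻¹) * (U * W⁻¹)ᴴ * ((W * V * C)ᴴ * (diagonal μ)⁻¹ * (W * V * C)) * C⁻¹
      = U * W⁻¹ * ((W⁻¹)ᴴ * (Uᴴ * C * Vᴴ) * Wᴴ) * (diagonal μ)⁻¹ * W * V * (C * C⁻¹) := by
        simp only [conjTranspose_mul, hC.isHermitian.eq, Matrix.mul_assoc]
    _ = U * W⁻¹ * (((W⁻¹)ᴴ * Wᴴ) * diagonal μ * ((W⁻¹)ᴴ * Wᴴ)) * (diagonal μ)⁻¹ * W * V := by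
        rw [hUCV, mul_nonsing_inv _ hCu, Matrix.mul_one]
        simp only [Matrix.mul_assoc]
    _ = T := by
        rw [hWW, Matrix.one_mul, Matrix.mul_one, mul_nonsing_inv_cancel_right _ _ hDu,
          nonsing_inv_mul_cancel_right _ _ hWu, hT]

theorem eq_zero_of_isNilpotent_of_mulVec_imp {N : Matrix n n ℂ} (hN : IsNilpotent N)
    (h : ∀ v, N *ᵥ v = 0 → Nᴴ *ᵥ v = 0) : N = 0 := by
  have hmat (B : Matrix n n ℂ) (hB : N * B = 0) : Nᴴ * B = 0 := by
    ext i j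
    have : N *ᵥ B.col j = 0 := by
      ext k
      exact congrFun (congrFun hB k) j
    exact congrFun (h _ this) i
  obtain ⟨k, hk⟩ := hN
  induction k with
  | zero =>
    rw [pow_zero] at hk
    rw [← Matrix.mul_one N, hk, Matrix.mul_zero]
  | succ k ih =>
    cases k with
    | zero => simpa using hk
    | succ k =>
      refine ih ?_
      have h1 := hmat (N ^ (k + 1)) (by rw [← pow_succ', hk])
      rw [pow_succ', ← Matrix.mul_assoc, conjTranspose_mul_self_mul_eq_zero] at h1
      rw [pow_succ', h1]

end Complex

end Matrix

open Matrix in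
theorem product_of_three_psd_of_not_block_diag (m p : ℕ) (hm : 1 ≤ m) (hp : 1 ≤ p)
    (T1 : Matrix (Fin m) (Fin m) ℂ) (R : Matrix (Fin m) (Fin p) ℂ)
    (T2 : Matrix (Fin p) (Fin p) ℂ)
    (hT1 : IsUnit T1) (hT2 : IsNilpotent T2)
    (h : R ≠ 0 ∨ T2 ≠ 0) :
    ∃ P1 P2 P3 : Matrix (Fin m ⊕ Fin p) (Fin m ⊕ Fin p) ℂ,
      P1.PosSemidef ∧ P2.PosSemidef ∧ P3.PosSemidef ∧
      Matrix.fromBlocks T1 R 0 T2 = P1 * P2 * P3 := by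
  by_contra hcon
  have hker (a) (ha : fromBlocks T1 R 0 T2 *ᵥ a = 0) : (fromBlocks T1 R 0 T2)ᴴ *ᵥ a = 0 :=
    not_not.mp fun ha' => hcon (exists_posSemidef_mul_mul_of_mulVec_eq_zero ha ha')
  have hT1d : IsUnit T1.det := (isUnit_iff_isUnit_det _).mp hT1
  have hT1H : IsUnit T1ᴴ := hT1.star
  have key (v : Fin p → ℂ) (hv : T2 *ᵥ v = 0) : R *ᵥ v = 0 ∧ T2ᴴ *ᵥ v = 0 := by
    have h1 := hker (Sum.elim (-(T1⁻¹ *ᵥ R *ᵥ v)) v) (by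
      rw [fromBlocks_mulVec]
      simp [hv, mulVec_neg, mulVec_mulVec, mul_nonsing_inv_cancel_left _ _ hT1d])
    rw [fromBlocks_conjTranspose, fromBlocks_mulVec] at h1
    have h2 := congrArg (· ∘ Sum.inl) h1
    have h3 := congrArg (· ∘ Sum.inr) h1
    simp only [Sum.elim_comp_inl, Sum.elim_comp_inr, conjTranspose_zero, zero_mulVec,
      add_zero, Pi.zero_comp] at h2 h3
    have h4 : -(T1⁻¹ *ᵥ R *ᵥ v) = 0 :=
      mulVec_injective_of_isUnit hT1H (h2.trans (mulVec_zero _).symm)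
    rw [h4, mulVec_zero, zero_add] at h3
    refine ⟨?_, h3⟩
    have h5 := congrArg (T1 *ᵥ ·) (neg_eq_zero.mp h4)
    simpa [mulVec_mulVec, mul_nonsing_inv_cancel_left _ _ hT1d] using h5
  have hT20 : T2 = 0 := eq_zero_of_isNilpotent_of_mulVec_imp hT2 fun v hv => (key v hv).2
  refine h.elim (fun hR => hR ?_) fun h => h hT20
  exact ext_of_mulVec_single fun j => by
    rw [(key _ (by rw [hT20, zero_mulVec])).1, zero_mulVec]
end

section
/- Let m, p ≥ 1, let T1 be an invertible m×m complex matrix, and let T = T1 ⊕ 0_p be the (m+p)×(m+p) block diagonal matrix with blocks T1 and the p×p zero matrix. If T is a product of three positive semi-definite matrices, then T1 is a product of three positive definite matrices. -/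
open scoped Matrix ComplexOrder

theorem Matrix.exists_mul_eq_of_mulVec_eq_zero {K l m n : Type*} [Field K] [Fintype l] [Fintype m]
    [Fintype n] (B : Matrix m n K) (C : Matrix l n K) (h : ∀ v, C *ᵥ v = 0 → B *ᵥ v = 0) :
    ∃ G : Matrix m l K, G * C = B := by
  classical
  obtain ⟨g, hg⟩ := C.mulVecLin.rangeRestrict.exists_rightInverse_of_surjective
    C.mulVecLin.range_rangeRestrict
  obtain ⟨G, hG⟩ := (B.mulVecLin ∘ₗ g).exists_extend
  refine ⟨LinearMap.toMatrix' G, Matrix.ext_of_mulVec_single fun i => ?_⟩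
  set v : n → K := Pi.single i 1
  have hGv := LinearMap.congr_fun hG (C.mulVecLin.rangeRestrict v)
  have hgv : C *ᵥ g (C.mulVecLin.rangeRestrict v) = C *ᵥ v :=
    congrArg Subtype.val (LinearMap.congr_fun hg (C.mulVecLin.rangeRestrict v))
  have hv := h (g (C.mulVecLin.rangeRestrict v) - v) (by rw [Matrix.mulVec_sub, hgv, sub_self])
  rw [Matrix.mulVec_sub, sub_eq_zero] at hv
  rw [← Matrix.mulVec_mulVec, LinearMap.toMatrix'_mulVec]
  exact hGv.trans hv

/-- Block elimination for a positive semi-definite matrix: `S` is a generalized Schur complement of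
the lower right block, which need not be invertible. -/
theorem Matrix.PosSemidef.exists_fromCols_mul_eq {𝕜 m n : Type*} [RCLike 𝕜] [Fintype m]
    [DecidableEq m] [Fintype n] {P : Matrix (m ⊕ n) (m ⊕ n) 𝕜} (hP : P.PosSemidef) :
    ∃ (G : Matrix m n 𝕜) (S : Matrix m m 𝕜),
      S.PosSemidef ∧ Matrix.fromCols (1 : Matrix m m 𝕜) G * P = Matrix.fromCols S 0 := by
  classical
  obtain ⟨G, hG⟩ := P.toBlocks₁₂.exists_mul_eq_of_mulVec_eq_zero P.toBlocks₂₂ fun v hv => by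
    have hmul : P *ᵥ Sum.elim 0 v = Sum.elim (P.toBlocks₁₂ *ᵥ v) (P.toBlocks₂₂ *ᵥ v) := by
      conv_lhs => rw [← Matrix.fromBlocks_toBlocks P]
      simp [Matrix.fromBlocks_mulVec]
    have hzero : P *ᵥ Sum.elim 0 v = 0 := by
      rw [← hP.dotProduct_mulVec_zero_iff, hmul, hv]
      simp [dotProduct]
    rw [hmul] at hzero
    exact funext fun i => congrFun hzero (Sum.inl i)
  have hrow : Matrix.fromCols (1 : Matrix m m 𝕜) (-G) * P =
      Matrix.fromCols (P.toBlocks₁₁ - G * P.toBlocks₂₁) 0 := by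
    conv_lhs => rw [← Matrix.fromBlocks_toBlocks P]
    simp [Matrix.fromCols_mul_fromBlocks, hG, sub_eq_add_neg]
  refine ⟨-G, _, ?_, hrow⟩
  have hS := hP.mul_mul_conjTranspose_same (Matrix.fromCols (1 : Matrix m m 𝕜) (-G))
  rwa [hrow, Matrix.conjTranspose_fromCols_eq_fromRows_conjTranspose,
    Matrix.fromCols_mul_fromRows, Matrix.conjTranspose_one, Matrix.mul_one, Matrix.zero_mul,
    add_zero] at hS

theorem block_diag_three_psd_imp_three_pd (m p : ℕ) (hm : 1 ≤ m) (hp : 1 ≤ p)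
    (T1 : Matrix (Fin m) (Fin m) ℂ) (hT1 : IsUnit T1)
    (h : ∃ P1 P2 P3 : Matrix (Fin m ⊕ Fin p) (Fin m ⊕ Fin p) ℂ,
      P1.PosSemidef ∧ P2.PosSemidef ∧ P3.PosSemidef ∧
      Matrix.fromBlocks T1 0 0 (0 : Matrix (Fin p) (Fin p) ℂ) = P1 * P2 * P3) :
    ∃ Q1 Q2 Q3 : Matrix (Fin m) (Fin m) ℂ,
      Q1.PosDef ∧ Q2.PosDef ∧ Q3.PosDef ∧ T1 = Q1 * Q2 * Q3 := by
  obtain ⟨P1, P2, P3, h1, h2, h3, hT⟩ := h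
  obtain ⟨G1, S1, hS1, hG1⟩ := h1.exists_fromCols_mul_eq
  obtain ⟨G3, S3, hS3, hG3⟩ := h3.exists_fromCols_mul_eq
  have hG3' : P3 * Matrix.fromRows (1 : Matrix (Fin m) (Fin m) ℂ) G3ᴴ =
      Matrix.fromRows S3 (0 : Matrix (Fin p) (Fin m) ℂ) := by
    simpa [Matrix.conjTranspose_mul, Matrix.conjTranspose_fromCols_eq_fromRows_conjTranspose,
      h3.isHermitian.eq, hS3.isHermitian.eq] using congrArg Matrix.conjTranspose hG3
  have hprod : T1 = S1 * P2.toBlocks₁₁ * S3 := calc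
    T1 = Matrix.fromCols (1 : Matrix (Fin m) (Fin m) ℂ) G1 *
          Matrix.fromBlocks T1 0 0 (0 : Matrix (Fin p) (Fin p) ℂ) *
          Matrix.fromRows (1 : Matrix (Fin m) (Fin m) ℂ) G3ᴴ := by
      simp [Matrix.fromCols_mul_fromBlocks, Matrix.fromCols_mul_fromRows]
    _ = (Matrix.fromCols (1 : Matrix (Fin m) (Fin m) ℂ) G1 * P1) * P2 *
          (P3 * Matrix.fromRows (1 : Matrix (Fin m) (Fin m) ℂ) G3ᴴ) := by
      simp only [hT, Matrix.mul_assoc]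
    _ = Matrix.fromCols S1 (0 : Matrix (Fin m) (Fin p) ℂ) *
          Matrix.fromBlocks P2.toBlocks₁₁ P2.toBlocks₁₂ P2.toBlocks₂₁ P2.toBlocks₂₂ *
          Matrix.fromRows S3 (0 : Matrix (Fin p) (Fin m) ℂ) := by
      rw [hG1, hG3', Matrix.fromBlocks_toBlocks]
    _ = S1 * P2.toBlocks₁₁ * S3 := by
      simp [Matrix.fromCols_mul_fromBlocks, Matrix.fromCols_mul_fromRows]
  have hA : P2.toBlocks₁₁.PosSemidef := h2.submatrix Sum.inl
  have hdet := (Matrix.isUnit_iff_isUnit_det _).mp hT1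
  rw [hprod, Matrix.det_mul, Matrix.det_mul, IsUnit.mul_iff, IsUnit.mul_iff] at hdet
  simp only [← Matrix.isUnit_iff_isUnit_det] at hdet
  obtain ⟨⟨hu1, hu2⟩, hu3⟩ := hdet
  exact ⟨S1, P2.toBlocks₁₁, S3, hS1.posDef_iff_isUnit.mpr hu1, hA.posDef_iff_isUnit.mpr hu2,
    hS3.posDef_iff_isUnit.mpr hu3, hprod⟩
end

section
/- Let A, S be n×n complex matrices with S invertible, and let k be a nonnegative integer. Then A can be written as a product of 2k+1 positive semi-definite matrices if and only if S*AS can be written as a product of 2k+1 positive semi-definite matrices, where S* denotes the conjugate transpose of S. -/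
open scoped Matrix ComplexOrder

/-- Congruence by an invertible matrix preserves being a product of an odd number of positive
semi-definite matrices. -/
theorem exists_psd_list_conjTranspose_mul_mul {n : ℕ} {S : Matrix (Fin n) (Fin n) ℂ}
    (hS : IsUnit S) (k : ℕ) (L : List (Matrix (Fin n) (Fin n) ℂ))
    (hlen : L.length = 2 * k + 1) (hL : ∀ P ∈ L, P.PosSemidef) :
    ∃ M : List (Matrix (Fin n) (Fin n) ℂ),
      M.length = 2 * k + 1 ∧ (∀ P ∈ M, P.PosSemidef) ∧ Sᴴ * L.prod * S = M.prod := by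
  have hdet : IsUnit S.det := (Matrix.isUnit_iff_isUnit_det S).1 hS
  induction k generalizing L with
  | zero =>
    obtain ⟨P, rfl⟩ := List.length_eq_one_iff.1 hlen
    refine ⟨[Sᴴ * P * S], rfl, ?_, by simp⟩
    simpa using (hL P (by simp)).conjTranspose_mul_mul_same S
  | succ k ih =>
    match L, hlen, hL with
    | P :: Q :: L, hlen, hL =>
      obtain ⟨M, hM, hMpos, hprod⟩ := ih L (by simp at hlen; omega)
        fun R hR => hL R (by simp [hR])
      refine ⟨(Sᴴ * P * S) :: (S⁻¹ * Q * S⁻¹ᴴ) :: M, by simp [hM]; omega, ?_, ?_⟩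
      · intro R hR
        rcases List.mem_cons.1 hR with rfl | hR
        · exact (hL P (by simp)).conjTranspose_mul_mul_same S
        rcases List.mem_cons.1 hR with rfl | hR
        · exact (hL Q (by simp)).mul_mul_conjTranspose_same S⁻¹
        · exact hMpos R hR
      · have hstar : S⁻¹ᴴ * Sᴴ = 1 := by
          rw [← Matrix.conjTranspose_mul, Matrix.mul_nonsing_inv S hdet,
            Matrix.conjTranspose_one]
        calc Sᴴ * (P :: Q :: L).prod * S
            = Sᴴ * P * (S * S⁻¹) * Q * (S⁻¹ᴴ * Sᴴ) * L.prod * S := by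
              simp only [hstar, Matrix.mul_nonsing_inv S hdet, List.prod_cons, mul_one, mul_assoc]
          _ = _ := by simp only [List.prod_cons, ← hprod, mul_assoc]

theorem odd_psd_product_congruence (n k : ℕ) (A S : Matrix (Fin n) (Fin n) ℂ)
    (hS : IsUnit S) :
    (∃ L : List (Matrix (Fin n) (Fin n) ℂ),
      L.length = 2 * k + 1 ∧ (∀ P ∈ L, P.PosSemidef) ∧ A = L.prod) ↔
    (∃ L : List (Matrix (Fin n) (Fin n) ℂ),
      L.length = 2 * k + 1 ∧ (∀ P ∈ L, P.PosSemidef) ∧ Sᴴ * A * S = L.prod) := by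
  have hdet : IsUnit S.det := (Matrix.isUnit_iff_isUnit_det S).1 hS
  constructor
  · rintro ⟨L, hlen, hL, rfl⟩
    exact exists_psd_list_conjTranspose_mul_mul hS k L hlen hL
  · rintro ⟨L, hlen, hL, hA⟩
    obtain ⟨M, hM, hMpos, hprod⟩ := exists_psd_list_conjTranspose_mul_mul
      ((Matrix.isUnit_nonsing_inv_iff).2 hS) k L hlen hL
    refine ⟨M, hM, hMpos, ?_⟩
    have hstar : S⁻¹ᴴ * Sᴴ = 1 := by
      rw [← Matrix.conjTranspose_mul, Matrix.mul_nonsing_inv S hdet, Matrix.conjTranspose_one]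
    calc A = (S⁻¹ᴴ * Sᴴ) * A * (S * S⁻¹) := by
          rw [hstar, Matrix.mul_nonsing_inv S hdet, one_mul, mul_one]
      _ = S⁻¹ᴴ * (Sᴴ * A * S) * S⁻¹ := by simp only [mul_assoc]
      _ = M.prod := by rw [hA, hprod]
end

section
/- Let m, p ≥ 1 and let T be the (m+p)×(m+p) complex block matrix T = [[T1, R],[0, 0_p]], where T1 is an invertible m×m complex matrix, R is a nonzero m×p complex matrix, and 0_p is the p×p zero matrix. Then T is a product of three positive semi-definite matrices. -/
open scoped Matrix ComplexOrder

open Polynomial in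
theorem Polynomial.exists_real_gt_eval_ne_zero {q : ℂ[X]} (hq : q ≠ 0) (c : ℝ) :
    ∃ r : ℝ, c < r ∧ q.eval (r : ℂ) ≠ 0 := by
  by_contra! h
  refine hq (q.eq_zero_of_infinite_isRoot ?_)
  refine ((Set.Ioi_infinite c).image Complex.ofReal_injective.injOn).mono ?_
  rintro _ ⟨r, hr, rfl⟩
  exact h r hr

namespace Matrix

open scoped MatrixOrder Matrix.Norms.L2Operator in
theorem IsHermitian.exists_posDef_add_smul_one {n : Type*} [Fintype n] [DecidableEq n]
    {H : Matrix n n ℂ} (hH : H.IsHermitian) :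
    ∃ c : ℝ, ∀ r : ℝ, c < r → (H + (r : ℂ) • (1 : Matrix n n ℂ)).PosDef := by
  refine ⟨‖H‖, fun r hr => ?_⟩
  have hle : -algebraMap ℝ (Matrix n n ℂ) ‖H‖ ≤ H :=
    IsSelfAdjoint.neg_algebraMap_norm_le_self (a := H) hH
  have hpsd : (H + ((‖H‖ : ℝ) : ℂ) • (1 : Matrix n n ℂ)).PosSemidef := by
    have h := Matrix.le_iff.mp hle
    rw [sub_neg_eq_add, Algebra.algebraMap_eq_smul_one] at h
    rwa [← Complex.coe_smul] at h
  have hpd : (((r - ‖H‖ : ℝ) : ℂ) • (1 : Matrix n n ℂ)).PosDef :=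
    PosDef.smul PosDef.one (by exact_mod_cast sub_pos.mpr hr)
  have h := PosDef.posSemidef_add hpsd hpd
  rwa [add_assoc, ← add_smul, ← Complex.ofReal_add, add_sub_cancel] at h

/-- Positive definite matrices are Zariski dense: a function that is polynomial along lines and
does not vanish identically is nonzero at some positive definite matrix. -/
theorem exists_posDef_ne_zero {n : Type*} [Fintype n] [DecidableEq n] {f : Matrix n n ℂ → ℂ}
    (hf : ∀ A B : Matrix n n ℂ, ∃ q : Polynomial ℂ, ∀ s : ℂ, q.eval s = f (A + s • B))
    {M : Matrix n n ℂ} (hM : f M ≠ 0) : ∃ X : Matrix n n ℂ, X.PosDef ∧ f X ≠ 0 := by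
  set H : Matrix n n ℂ := (realPart M : Matrix n n ℂ)
  set K : Matrix n n ℂ := (imaginaryPart M : Matrix n n ℂ)
  have hH : H.IsHermitian := (realPart M).2
  have hK : K.IsHermitian := (imaginaryPart M).2
  obtain ⟨q, hq⟩ := hf H K
  have hq0 : q ≠ 0 := by
    rintro rfl
    apply hM
    rw [← realPart_add_I_smul_imaginaryPart M, ← hq, Polynomial.eval_zero]
  obtain ⟨s, -, hs⟩ := Polynomial.exists_real_gt_eval_ne_zero hq0 0
  rw [hq] at hs
  have hHK : (H + (s : ℂ) • K).IsHermitian := by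
    refine hH.add ?_
    rw [IsHermitian, conjTranspose_smul, hK.eq, Complex.star_def, Complex.conj_ofReal]
  obtain ⟨c, hc⟩ := hHK.exists_posDef_add_smul_one
  obtain ⟨q', hq'⟩ := hf (H + (s : ℂ) • K) 1
  have hq'0 : q' ≠ 0 := by
    rintro rfl
    apply hs
    simpa using (hq' 0).symm
  obtain ⟨r, hr, hr'⟩ := Polynomial.exists_real_gt_eval_ne_zero hq'0 c
  exact ⟨_, hc r hr, hq' r ▸ hr'⟩

/-- The matrix whose `i`-th column is `adjugate (l i • 1 - A) *ᵥ u`. -/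
def adjugateColumns {n R : Type*} [Fintype n] [DecidableEq n] [CommRing R] (l : n → R)
    (A : Matrix n n R) (u : n → R) : Matrix n n R :=
  of fun k i => (adjugate (scalar n (l i) - A) *ᵥ u) k

theorem map_adjugateColumns {n R S : Type*} [Fintype n] [DecidableEq n] [CommRing R] [CommRing S]
    (φ : R →+* S) (l : n → R) (A : Matrix n n R) (u : n → R) :
    (adjugateColumns l A u).map φ = adjugateColumns (φ ∘ l) (A.map φ) (φ ∘ u) := by
  ext k i
  have h : (scalar n (l i) - A).map φ = scalar n (φ (l i)) - A.map φ := by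
    ext a b
    by_cases hab : a = b <;> simp [hab]
  have hadj := φ.map_adjugate (scalar n (l i) - A)
  rw [RingHom.mapMatrix_apply, RingHom.mapMatrix_apply, h] at hadj
  simp only [adjugateColumns, map_apply, of_apply, RingHom.map_mulVec, hadj, Function.comp_apply]

theorem mul_adjugateColumns {n R : Type*} [Fintype n] [DecidableEq n] [CommRing R] (l : n → R)
    (A : Matrix n n R) (u : n → R) :
    A * adjugateColumns l A u + vecMulVec u (fun i => (scalar n (l i) - A).det) =
      adjugateColumns l A u * diagonal l := by
  ext k i
  have h := congrFun (congrArg (· *ᵥ u) (mul_adjugate (scalar n (l i) - A))) k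
  simp only [← mulVec_mulVec, sub_mulVec, Pi.sub_apply, smul_mulVec, one_mulVec, Pi.smul_apply,
    smul_eq_mul] at h
  have hs : (scalar n (l i) *ᵥ (adjugate (scalar n (l i) - A) *ᵥ u)) k =
      l i * (adjugate (scalar n (l i) - A) *ᵥ u) k := by
    simp [scalar_apply, mulVec_diagonal]
  rw [hs] at h
  have hA : (A * adjugateColumns l A u) k i =
      (A *ᵥ (adjugate (scalar n (l i) - A) *ᵥ u)) k := rfl
  rw [add_apply, hA, vecMulVec_apply, mul_diagonal]
  simp only [adjugateColumns, of_apply]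
  linear_combination -h

theorem exists_polynomial_det_adjugateColumns {n : Type*} [Fintype n] [DecidableEq n]
    (l u : n → ℂ) (T A B : Matrix n n ℂ) :
    ∃ q : Polynomial ℂ, ∀ s : ℂ,
      q.eval s = (adjugateColumns l (T * (A + s • B)) u).det := by
  refine ⟨(adjugateColumns (Polynomial.C ∘ l)
    (T.map Polynomial.C * (A.map Polynomial.C + (Polynomial.X : Polynomial ℂ) •
      B.map Polynomial.C)) (Polynomial.C ∘ u)).det, fun s => ?_⟩
  rw [← Polynomial.coe_evalRingHom, RingHom.map_det, RingHom.mapMatrix_apply,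
    map_adjugateColumns]
  congr 2
  · ext i
    simp
  · ext i j
    simp [mul_apply, Polynomial.eval_finsetSum, mul_comm s]
  · ext i
    simp

theorem exists_isUnit_mulVec_eq {n : Type*} [Fintype n] [DecidableEq n] {x y : n → ℂ}
    (hx : x ≠ 0) (hy : y ≠ 0) : ∃ Q : Matrix n n ℂ, IsUnit Q ∧ Q *ᵥ x = y := by
  obtain ⟨A, hA⟩ := SeparatingDual.exists_continuousLinearEquiv_apply_eq (R := ℂ) hx hy
  refine ⟨LinearMap.toMatrix' A.toLinearEquiv, ?_, ?_⟩
  · rw [isUnit_iff_isUnit_det, LinearMap.det_toMatrix']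
    exact A.toLinearEquiv.isUnit_det'
  · rw [LinearMap.toMatrix'_mulVec]
    exact hA

theorem adjugate_eq_det_smul_inv {n R : Type*} [Fintype n] [DecidableEq n] [CommRing R]
    {A : Matrix n n R} (hA : IsUnit A.det) : adjugate A = A.det • A⁻¹ := by
  rw [inv_def, smul_smul, Ring.mul_inverse_cancel _ hA, one_smul]

theorem adjugate_mul_mul_inv {n R : Type*} [Fintype n] [DecidableEq n] [CommRing R]
    {Q : Matrix n n R} (hQ : IsUnit Q.det) (A : Matrix n n R) :
    adjugate (Q * A * Q⁻¹) = Q * adjugate A * Q⁻¹ := by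
  rw [adjugate_mul_distrib, adjugate_mul_distrib, adjugate_eq_det_smul_inv hQ,
    adjugate_eq_det_smul_inv (isUnit_nonsing_inv_det Q hQ), nonsing_inv_nonsing_inv _ hQ]
  simp only [Matrix.smul_mul, Matrix.mul_smul, smul_smul]
  rw [mul_comm Q.det, det_nonsing_inv_mul_det _ hQ, one_smul, Matrix.mul_assoc]

theorem exists_det_adjugateColumns_ne_zero {n : Type*} [Fintype n] [DecidableEq n]
    {l u : n → ℂ} (hl : Function.Injective l) (hu : u ≠ 0) :
    ∃ A : Matrix n n ℂ, (adjugateColumns l A u).det ≠ 0 := by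
  obtain ⟨i₀, -⟩ := Function.ne_iff.mp hu
  have hone : (1 : n → ℂ) ≠ 0 := fun h => one_ne_zero (congrFun h i₀)
  obtain ⟨Q, hQ, hQu⟩ := exists_isUnit_mulVec_eq hone hu
  have hdet : IsUnit Q.det := (isUnit_iff_isUnit_det Q).mp hQ
  refine ⟨Q * diagonal l * Q⁻¹, ?_⟩
  set c : n → ℂ := fun i => ∏ j ∈ Finset.univ.erase i, (l i - l j)
  have hc : ∀ i, c i ≠ 0 := fun i => Finset.prod_ne_zero_iff.mpr fun j hj =>
    sub_ne_zero.mpr (hl.ne (Finset.ne_of_mem_erase hj).symm)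
  suffices h : adjugateColumns l (Q * diagonal l * Q⁻¹) u = Q * diagonal c by
    rw [h, det_mul, det_diagonal]
    exact mul_ne_zero hdet.ne_zero (Finset.prod_ne_zero_iff.mpr fun i _ => hc i)
  ext k i
  have hconj : scalar n (l i) - Q * diagonal l * Q⁻¹ =
      Q * diagonal (fun j => l i - l j) * Q⁻¹ := by
    have : diagonal (fun j => l i - l j) = scalar n (l i) - diagonal l := by
      rw [scalar_apply, diagonal_sub]
    rw [this, mul_sub, sub_mul, ← (scalar_commute (l i) (fun _ => mul_comm _ _) Q).eq,
      mul_nonsing_inv_cancel_right _ _ hdet]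
  have hadj : adjugate (scalar n (l i) - Q * diagonal l * Q⁻¹) *ᵥ u =
      Q *ᵥ (adjugate (diagonal fun j => l i - l j) *ᵥ 1) := by
    rw [hconj, adjugate_mul_mul_inv hdet, ← hQu, mulVec_mulVec, mulVec_mulVec,
      nonsing_inv_mul_cancel_right _ _ hdet]
  have hvec : adjugate (diagonal fun j => l i - l j) *ᵥ (1 : n → ℂ) = Pi.single i (c i) := by
    rw [adjugate_diagonal]
    ext j
    rw [mulVec_diagonal, Pi.one_apply, mul_one]
    by_cases hij : j = i
    · subst hij
      simp [c]
    · rw [Pi.single_eq_of_ne hij]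
      exact Finset.prod_eq_zero (Finset.mem_erase.mpr ⟨Ne.symm hij, Finset.mem_univ i⟩)
        (sub_self _)
  rw [mul_diagonal]
  simp only [adjugateColumns, of_apply]
  rw [hadj, hvec, mulVec_single]
  simp

theorem exists_posDef_mul_add_vecMulVec_diagonalizable {n : Type*} [Fintype n] [DecidableEq n]
    {T : Matrix n n ℂ} (hT : IsUnit T) {l u : n → ℂ} (hl : Function.Injective l) (hu : u ≠ 0) :
    ∃ (X : Matrix n n ℂ) (w : n → ℂ) (S : Matrix n n ℂ), X.PosDef ∧ IsUnit S ∧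
      (T * X + vecMulVec u w) * S = S * diagonal l := by
  have hTdet : IsUnit T.det := (isUnit_iff_isUnit_det T).mp hT
  obtain ⟨A, hA⟩ := exists_det_adjugateColumns_ne_zero hl hu
  obtain ⟨X, hX, hS⟩ := exists_posDef_ne_zero
    (f := fun X => (adjugateColumns l (T * X) u).det) (M := T⁻¹ * A)
    (exists_polynomial_det_adjugateColumns l u T)
    (by simpa only [mul_nonsing_inv_cancel_left _ _ hTdet] using hA)
  set S := adjugateColumns l (T * X) u
  have hSdet : IsUnit S.det := isUnit_iff_ne_zero.mpr hS
  refine ⟨X, (fun i => (scalar n (l i) - T * X).det) ᵥ* S⁻¹, S, hX,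
    (isUnit_iff_isUnit_det S).mpr hSdet, ?_⟩
  rw [add_mul, vecMulVec_mul, vecMul_vecMul, nonsing_inv_mul _ hSdet, vecMul_one]
  exact mul_adjugateColumns l (T * X) u

/-- A product `U * V` is a product of two positive semi-definite matrices when `V * U` is similar
to a positive definite diagonal matrix. -/
theorem exists_posSemidef_mul_eq_of_mul_eq_diagonal {m n : Type*} [Fintype m] [DecidableEq m]
    [Fintype n] {U : Matrix n m ℂ} {V : Matrix m n ℂ} {S : Matrix m m ℂ} {l : m → ℂ}
    (hl : ∀ i, 0 < l i) (hS : IsUnit S) (h : V * U * S = S * diagonal l) :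
    ∃ P Q : Matrix n n ℂ, P.PosSemidef ∧ Q.PosSemidef ∧ U * V = P * Q := by
  have hSdet : IsUnit S.det := (isUnit_iff_isUnit_det S).mp hS
  have hdiag : (diagonal fun i => (l i)⁻¹).PosSemidef :=
    PosSemidef.diagonal fun i => (RCLike.inv_pos_of_pos (hl i)).le
  have hVU : S⁻¹ * V * (U * S) = diagonal l := by
    rw [Matrix.mul_assoc, ← Matrix.mul_assoc V, h, nonsing_inv_mul_cancel_left _ _ hSdet]
  have hVU' : (U * S)ᴴ * (S⁻¹ * V)ᴴ = diagonal l := by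
    rw [← conjTranspose_mul, hVU, diagonal_conjTranspose]
    congr 1
    ext i
    exact (IsSelfAdjoint.of_nonneg (hl i).le).star_eq
  refine ⟨U * S * (diagonal fun i => (l i)⁻¹) * (U * S)ᴴ, (S⁻¹ * V)ᴴ * (S⁻¹ * V),
    hdiag.mul_mul_conjTranspose_same _, posSemidef_conjTranspose_mul_self _, ?_⟩
  have hcancel : (diagonal fun i => (l i)⁻¹) * diagonal l = 1 := by
    rw [diagonal_mul_diagonal, ← diagonal_one]
    congr 1
    ext i
    exact inv_mul_cancel₀ (hl i).ne'
  calc U * V = U * S * (1 : Matrix m m ℂ) * (S⁻¹ * V) := by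
        rw [Matrix.mul_one, Matrix.mul_assoc, mul_nonsing_inv_cancel_left _ _ hSdet]
    _ = _ := by
        rw [← hcancel, ← hVU']
        simp only [Matrix.mul_assoc]

theorem PosDef.exists_posDef_fromBlocks {m n : Type*} [Fintype m] [DecidableEq m] [Fintype n]
    [DecidableEq n] {X : Matrix m m ℂ} (hX : X.PosDef) (Y : Matrix m n ℂ) :
    ∃ Z : Matrix n n ℂ, (fromBlocks X Y Yᴴ Z).PosDef := by
  let : Invertible X := hX.isUnit.invertible
  refine ⟨Yᴴ * X⁻¹ * Y + 1, ?_⟩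
  have hpsd : (fromBlocks X Y Yᴴ (Yᴴ * X⁻¹ * Y + 1)).PosSemidef := by
    rw [PosDef.fromBlocks₁₁ Y _ hX, add_sub_cancel_left]
    exact PosSemidef.one
  rw [hpsd.posDef_iff_isUnit, isUnit_iff_isUnit_det, det_fromBlocks₁₁, invOf_eq_nonsing_inv,
    add_sub_cancel_left, det_one, mul_one]
  exact (isUnit_iff_isUnit_det X).mp hX.isUnit

end Matrix

open Matrix in
theorem three_psd_of_nonzero_corner (m p : ℕ) (hm : 1 ≤ m) (hp : 1 ≤ p)
    (T1 : Matrix (Fin m) (Fin m) ℂ) (R : Matrix (Fin m) (Fin p) ℂ)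
    (hT1 : IsUnit T1) (hR : R ≠ 0) :
    ∃ P1 P2 P3 : Matrix (Fin m ⊕ Fin p) (Fin m ⊕ Fin p) ℂ,
      P1.PosSemidef ∧ P2.PosSemidef ∧ P3.PosSemidef ∧
      Matrix.fromBlocks T1 R 0 (0 : Matrix (Fin p) (Fin p) ℂ) = P1 * P2 * P3 := by
  obtain ⟨j, hj⟩ : ∃ j, R.col j ≠ 0 := by
    by_contra! h
    exact hR (Matrix.ext fun i j => congrFun (h j) i)
  set l : Fin m → ℂ := fun i => (i : ℂ) + 1
  have hl : Function.Injective l := fun a b hab => Fin.ext (by simpa [l] using hab)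
  have hlpos : ∀ i, 0 < l i := fun i => by
    have : (0 : ℂ) ≤ ((i : ℕ) : ℂ) := Nat.cast_nonneg _
    positivity
  obtain ⟨X, w, S, hX, hS, hXS⟩ := exists_posDef_mul_add_vecMulVec_diagonalizable hT1 hl hj
  set W : Matrix (Fin p) (Fin m) ℂ := vecMulVec (Pi.single j 1) w
  have hRW : R * W = vecMulVec (R.col j) w := by
    rw [mul_vecMulVec, mulVec_single_one]
  obtain ⟨Z, hZ⟩ := hX.exists_posDef_fromBlocks Wᴴ
  rw [conjTranspose_conjTranspose] at hZ
  set G := fromBlocks X Wᴴ W Z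
  have hGdet : IsUnit G.det := (isUnit_iff_isUnit_det G).mp hZ.isUnit
  obtain ⟨P, Q, hP, hQ, hPQ⟩ := exists_posSemidef_mul_eq_of_mul_eq_diagonal
    (U := fromRows X W) (V := fromCols T1 R) hlpos hS (by rw [fromCols_mul_fromRows, hRW, hXS])
  refine ⟨G⁻¹, P, Q, hZ.posSemidef.inv, hP, hQ, ?_⟩
  have hGT : G * fromBlocks T1 R 0 0 = fromRows X W * fromCols T1 R := by
    rw [fromRows_mul_fromCols, fromBlocks_multiply]
    simp
  rw [mul_assoc, ← hPQ, ← hGT, nonsing_inv_mul_cancel_left _ _ hGdet]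
end

section
/- Let T1 be an invertible m×m complex matrix and let R be a nonzero m×p complex matrix. Then there exists a p×m complex matrix S such that T1 + RS is a product of three positive definite matrices. -/
open scoped Matrix ComplexOrder

namespace Matrix

variable {n K : Type*} [Fintype n] [DecidableEq n]

/-- The matrix whose `i`-th column is `adj (d i - N) u`, a rescaled resolvent of `N` at `d i`
applied to `u`. -/
def resolventColumns [CommRing K] (N : Matrix n n K) (u d : n → K) : Matrix n n K :=
  of fun j i => (adjugate (scalar n (d i) - N) *ᵥ u) j

theorem map_resolventColumns {L : Type*} [CommRing K] [CommRing L] (f : K →+* L)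
    (N : Matrix n n K) (u d : n → K) :
    f.mapMatrix (resolventColumns N u d) =
      resolventColumns (f.mapMatrix N) (f ∘ u) (f ∘ d) := by
  ext j i
  have h : scalar n (f (d i)) - f.mapMatrix N = f.mapMatrix (scalar n (d i) - N) := by
    rw [map_sub]
    congr 1
    ext a b
    by_cases hab : a = b <;> simp [hab, scalar_apply]
  simp only [resolventColumns, of_apply, Function.comp_apply]
  rw [h, ← RingHom.map_adjugate, RingHom.mapMatrix_apply, RingHom.mapMatrix_apply]
  exact RingHom.map_mulVec f _ u j

theorem exists_polynomial_eval_eq_det_resolventColumns [CommRing K] (A B : Matrix n n K)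
    (u d : n → K) :
    ∃ q : Polynomial K, ∀ t, q.eval t = (resolventColumns (A + t • B) u d).det := by
  refine ⟨(resolventColumns
    (A.map Polynomial.C + (Polynomial.X : Polynomial K) • B.map Polynomial.C)
    (Polynomial.C ∘ u) (Polynomial.C ∘ d)).det, fun t => ?_⟩
  rw [← Polynomial.coe_evalRingHom t, RingHom.map_det, map_resolventColumns]
  congr 2
  · ext a b
    simp
    ring
  · ext a
    simp
  · ext a
    simp

/-- Pole placement: a rank-one correction along `u` diagonalizes `N` with spectrum `d`. -/
theorem exists_add_vecMulVec_mul_eq [Field K] (N : Matrix n n K) (u d : n → K)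
    (h : IsUnit (resolventColumns N u d)) :
    ∃ w, (N + vecMulVec u w) * resolventColumns N u d =
      resolventColumns N u d * diagonal d := by
  set X := resolventColumns N u d
  have hdet : IsUnit X.det := (isUnit_iff_isUnit_det X).1 h
  refine ⟨(fun i => (scalar n (d i) - N).det) ᵥ* X⁻¹, ?_⟩
  rw [add_mul, vecMulVec_mul, vecMul_vecMul, nonsing_inv_mul X hdet, vecMul_one]
  ext j i
  have key : (scalar n (d i) - N) *ᵥ (adjugate (scalar n (d i) - N) *ᵥ u) =
      (scalar n (d i) - N).det • u := by
    rw [mulVec_mulVec, mul_adjugate, smul_mulVec, one_mulVec]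
  have hj := congrFun key j
  rw [sub_mulVec, scalar_apply] at hj
  simp only [Pi.sub_apply, mulVec_diagonal, Pi.smul_apply, smul_eq_mul] at hj
  have hcol : (N * X) j i = (N *ᵥ (adjugate (scalar n (d i) - N) *ᵥ u)) j := rfl
  have hent : X j i = (adjugate (scalar n (d i) - N) *ᵥ u) j := rfl
  rw [add_apply, mul_diagonal, vecMulVec_apply, hcol, hent]
  simp only [scalar_apply] at hj ⊢
  linear_combination -hj

theorem exists_isUnit_mulVec_one_eq {u : n → ℂ} (hu : u ≠ 0) :
    ∃ X : Matrix n n ℂ, IsUnit X ∧ X *ᵥ 1 = u := by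
  have : Nonempty n := by
    by_contra! h
    exact hu (Subsingleton.elim _ _)
  obtain ⟨e, he⟩ := SeparatingDual.exists_continuousLinearEquiv_apply_eq (R := ℂ)
    (x := (1 : n → ℂ)) (y := u) one_ne_zero hu
  refine ⟨LinearMap.toMatrix' (e.toLinearEquiv : (n → ℂ) →ₗ[ℂ] n → ℂ), ?_, ?_⟩
  · rw [isUnit_iff_isUnit_det, LinearMap.det_toMatrix']
    exact e.toLinearEquiv.isUnit_det'
  · rw [LinearMap.toMatrix'_mulVec]
    exact he

theorem exists_isUnit_resolventColumns {u d : n → ℂ} (hu : u ≠ 0) (hd : Function.Injective d) :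
    ∃ N : Matrix n n ℂ, IsUnit (resolventColumns N u d) := by
  obtain ⟨X, hX, hXu⟩ := exists_isUnit_mulVec_one_eq hu
  have hXdet := (isUnit_iff_isUnit_det X).1 hX
  let M : Matrix n n ℂ := diagonal d - vecMulVec 1 1
  let N := X * M * X⁻¹
  have hshift (i : n) : scalar n (d i) - N = X * (scalar n (d i) - M) * X⁻¹ := by
    rw [mul_sub, sub_mul, ← (scalar_commute (d i) (fun r => Commute.all _ r) X).eq,
      mul_assoc (scalar n (d i)), mul_nonsing_inv X hXdet, mul_one]
  have hdet (i : n) : (scalar n (d i) - N).det ≠ 0 := by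
    rw [hshift, det_conj hX]
    intro h0
    obtain ⟨y, hy0, hy⟩ := exists_mulVec_eq_zero_iff.2 h0
    have hrow (j : n) : (d i - d j) * y j + ∑ k, y k = 0 := by
      have := congrFun hy j
      simp only [M, scalar_apply, sub_mulVec, vecMulVec_mulVec, Pi.sub_apply, mulVec_diagonal,
        Pi.smul_apply, Pi.zero_apply, Pi.one_apply, one_dotProduct, MulOpposite.smul_eq_mul_unop,
        MulOpposite.unop_op, one_mul] at this
      linear_combination this
    have hsum : ∑ k, y k = 0 := by simpa using hrow i
    have hne (j : n) (hj : j ≠ i) : y j = 0 := by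
      have := hrow j
      rw [hsum, add_zero, mul_eq_zero, sub_eq_zero] at this
      exact this.resolve_left fun h => hj (hd h.symm)
    apply hy0
    ext j
    by_cases hj : j = i
    · rw [Finset.sum_eq_single i (fun k _ hk => hne k hk) (by simp)] at hsum
      rw [hj, hsum, Pi.zero_apply]
    · exact hne j hj
  have hcol (i : n) : (scalar n (d i) - N) *ᵥ X.col i = u := by
    rw [hshift, ← mulVec_single_one, mulVec_mulVec, mul_assoc, nonsing_inv_mul X hXdet, mul_one,
      ← mulVec_mulVec, ← hXu]
    congr 1
    ext j
    by_cases hj : j = i <;>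
      simp [M, scalar_apply, hj]
  have heq : resolventColumns N u d = X * diagonal fun i => (scalar n (d i) - N).det := by
    ext j i
    have hadj : adjugate (scalar n (d i) - N) *ᵥ u = (scalar n (d i) - N).det • X.col i := by
      rw [← hcol i, mulVec_mulVec, adjugate_mul, smul_mulVec, one_mulVec]
    rw [mul_diagonal, resolventColumns, of_apply, hadj, Pi.smul_apply, smul_eq_mul, mul_comm,
      col_apply]
  refine ⟨N, ?_⟩
  rw [heq, isUnit_iff_isUnit_det, det_mul, det_diagonal]
  exact hXdet.mul (isUnit_iff_ne_zero.2 (Finset.prod_ne_zero_iff.2 fun i _ => hdet i))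

open scoped MatrixOrder Norms.L2Operator in
theorem IsHermitian.exists_forall_gt_posDef_add_smul_one {H : Matrix n n ℂ}
    (hH : H.IsHermitian) : ∃ c : ℝ, ∀ s > c, (H + (s : ℂ) • (1 : Matrix n n ℂ)).PosDef := by
  refine ⟨‖H‖, fun s hs => ?_⟩
  have h1 : (H - -algebraMap ℝ (Matrix n n ℂ) ‖H‖).PosSemidef :=
    le_iff.1 (IsSelfAdjoint.neg_algebraMap_norm_le_self (a := H) hH)
  have h2 : (((s - ‖H‖ : ℝ) : ℂ) • (1 : Matrix n n ℂ)).PosDef :=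
    PosDef.one.smul (by exact_mod_cast sub_pos.2 hs)
  convert PosDef.posSemidef_add h1 h2 using 1
  rw [Algebra.algebraMap_eq_smul_one]
  ext a b
  simp
  ring

end Matrix

theorem Polynomial.exists_ofReal_gt_eval_ne_zero {q : Polynomial ℂ} (hq : q ≠ 0) (c : ℝ) :
    ∃ s > c, q.eval (s : ℂ) ≠ 0 := by
  have hfin : {s : ℝ | q.eval (s : ℂ) = 0}.Finite :=
    (q.finite_setOfPred_isRoot hq).preimage Complex.ofReal_injective.injOn
  obtain ⟨s, hs, hsq⟩ := (Set.Ioi_infinite c).exists_notMem_finite hfin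
  exact ⟨s, hs, hsq⟩

namespace Matrix

variable {n : Type*} [Fintype n] [DecidableEq n]

theorem exists_posDef_isUnit_resolventColumns {T : Matrix n n ℂ} (hT : IsUnit T) {u d : n → ℂ}
    (hu : u ≠ 0) (hd : Function.Injective d) :
    ∃ P : Matrix n n ℂ, P.PosDef ∧ IsUnit (resolventColumns (T * P) u d) := by
  obtain ⟨N, hN⟩ := exists_isUnit_resolventColumns hu hd
  let Q := T⁻¹ * N
  have hTQ : T * Q = N := mul_nonsing_inv_cancel_left T N ((isUnit_iff_isUnit_det T).1 hT)
  let H : Matrix n n ℂ := realPart Q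
  let L : Matrix n n ℂ := imaginaryPart Q
  have hH : H.IsHermitian := (realPart Q).2
  have hL : L.IsHermitian := (imaginaryPart Q).2
  have hQ : H + Complex.I • L = Q := realPart_add_I_smul_imaginaryPart Q
  obtain ⟨q, hq⟩ := exists_polynomial_eval_eq_det_resolventColumns (T * H) (T * L) u d
  have hq0 : q ≠ 0 := by
    rintro rfl
    have h := hq Complex.I
    rw [← Matrix.mul_smul, ← mul_add, hQ, hTQ, Polynomial.eval_zero] at h
    exact ((isUnit_iff_isUnit_det _).1 hN).ne_zero h.symm
  obtain ⟨t, -, ht⟩ := Polynomial.exists_ofReal_gt_eval_ne_zero hq0 0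
  have hHt : (H + (t : ℂ) • L).IsHermitian :=
    hH.add (hL.smul (Complex.conj_ofReal t))
  obtain ⟨c, hc⟩ := hHt.exists_forall_gt_posDef_add_smul_one
  obtain ⟨r, hr⟩ := exists_polynomial_eval_eq_det_resolventColumns (T * (H + (t : ℂ) • L))
    (T * 1) u d
  have hr0 : r ≠ 0 := by
    rintro rfl
    apply ht
    have h := hr 0
    rw [zero_smul, add_zero, Polynomial.eval_zero] at h
    rw [hq, ← Matrix.mul_smul, ← mul_add, ← h]
  obtain ⟨s, hs, hrs⟩ := Polynomial.exists_ofReal_gt_eval_ne_zero hr0 c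
  refine ⟨_, hc s hs, ?_⟩
  rw [hr, ← Matrix.mul_smul, ← mul_add] at hrs
  exact (isUnit_iff_isUnit_det _).2 (isUnit_iff_ne_zero.2 hrs)

theorem exists_posDef_mul_posDef_eq_conj_diagonal {X : Matrix n n ℂ} (hX : IsUnit X)
    {d : n → ℂ} (hd : ∀ i, 0 < d i) :
    ∃ A B : Matrix n n ℂ, A.PosDef ∧ B.PosDef ∧ X * diagonal d * X⁻¹ = A * B := by
  have hXXc : (X * Xᴴ).PosDef := by
    simpa using PosDef.one.mul_mul_conjTranspose_same (vecMul_injective_of_isUnit hX)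
  have hXc : IsUnit Xᴴ.det := by
    rw [det_conjTranspose]
    exact ((isUnit_iff_isUnit_det X).1 hX).star
  refine ⟨X * diagonal d * Xᴴ, (X * Xᴴ)⁻¹,
    (PosDef.diagonal hd).mul_mul_conjTranspose_same (vecMul_injective_of_isUnit hX),
    hXXc.inv, ?_⟩
  rw [mul_inv_rev, ← mul_assoc, mul_nonsing_inv_cancel_right _ _ hXc]

end Matrix

open Matrix in
theorem exists_correction_three_pd (m p : ℕ)
    (T1 : Matrix (Fin m) (Fin m) ℂ) (R : Matrix (Fin m) (Fin p) ℂ)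
    (hT1 : IsUnit T1) (hR : R ≠ 0) :
    ∃ S : Matrix (Fin p) (Fin m) ℂ,
      ∃ Q1 Q2 Q3 : Matrix (Fin m) (Fin m) ℂ,
        Q1.PosDef ∧ Q2.PosDef ∧ Q3.PosDef ∧ T1 + R * S = Q1 * Q2 * Q3 := by
  obtain ⟨c, hc⟩ : ∃ c, R *ᵥ c ≠ 0 := by
    by_contra! h
    exact hR (ext_of_mulVec_single fun i => by rw [h, zero_mulVec])
  let d : Fin m → ℂ := fun i => (i : ℕ) + 1
  have hd : Function.Injective d := fun i j h => Fin.ext (by simpa [d] using h)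
  have hdpos (i : Fin m) : 0 < d i := by
    have : (0 : ℂ) < ((i + 1 : ℕ) : ℂ) := Nat.cast_pos.2 (Nat.succ_pos _)
    simpa [d] using this
  obtain ⟨P, hP, hX⟩ := exists_posDef_isUnit_resolventColumns hT1 hc hd
  obtain ⟨w, hw⟩ := exists_add_vecMulVec_mul_eq _ _ _ hX
  obtain ⟨A, B, hA, hB, hAB⟩ := exists_posDef_mul_posDef_eq_conj_diagonal hX hdpos
  refine ⟨vecMulVec c w * P⁻¹, A, B, P⁻¹, hA, hB, hP.inv, ?_⟩
  rw [← hAB, ← hw, mul_nonsing_inv_cancel_right _ _ ((isUnit_iff_isUnit_det _).1 hX), add_mul,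
    mul_nonsing_inv_cancel_right _ _ ((isUnit_iff_isUnit_det _).1 hP.isUnit), ← Matrix.mul_assoc,
    mul_vecMulVec]
end

section
/- Let A be an n×n complex matrix with A = P1·P2·P3, where P1 and P2 are positive definite n×n matrices and P3 is a positive semi-definite n×n matrix. Then for every column vector X ∈ ℂⁿ, the (n+1)×(n+1) block matrix [[A, X],[0, 0]] is a product of three positive semi-definite matrices. -/
open scoped Matrix ComplexOrder

theorem border_column_three_psd (n : ℕ) (A P1 P2 P3 : Matrix (Fin n) (Fin n) ℂ)
    (hP1 : P1.PosDef) (hP2 : P2.PosDef) (hP3 : P3.PosSemidef)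
    (hA : A = P1 * P2 * P3) (X : Matrix (Fin n) (Fin 1) ℂ) :
    ∃ Q1 Q2 Q3 : Matrix (Fin n ⊕ Fin 1) (Fin n ⊕ Fin 1) ℂ,
      Q1.PosSemidef ∧ Q2.PosSemidef ∧ Q3.PosSemidef ∧
      Matrix.fromBlocks A X 0 (0 : Matrix (Fin 1) (Fin 1) ℂ) = Q1 * Q2 * Q3 := by
  have := hP1.isUnit.invertible
  have := hP2.isUnit.invertible
  set u := P1⁻¹ * X with hu
  refine ⟨Matrix.fromBlocks P1 0 0 0, Matrix.fromBlocks P2 u uᴴ (uᴴ * P2⁻¹ * u),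
    Matrix.fromBlocks P3 0 0 1, ?_, ?_, ?_, ?_⟩
  · simpa [Matrix.PosSemidef.zero] using
      Matrix.PosDef.fromBlocks₁₁ (0 : Matrix (Fin n) (Fin 1) ℂ) 0 hP1
  · rw [Matrix.PosDef.fromBlocks₁₁ _ _ hP2, sub_self]
    exact Matrix.PosSemidef.zero
  · have : Invertible (1 : Matrix (Fin 1) (Fin 1) ℂ) := invertibleOne
    have := Matrix.PosDef.fromBlocks₂₂ P3 (0 : Matrix (Fin n) (Fin 1) ℂ)
      (Matrix.PosDef.one (n := Fin 1) (R := ℂ))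
    simpa [hP3] using this
  · simp [Matrix.fromBlocks_multiply, hA, hu, ← Matrix.mul_assoc]
end

section
/- Let A be an n×n complex matrix with A = P1·P2·P3, where P1 is a positive semi-definite n×n matrix and P2 and P3 are positive definite n×n matrices. Then for every row vector Y (of size 1×n), the (n+1)×(n+1) block matrix [[A, 0],[Y, 0]] is a product of three positive semi-definite matrices. -/
open scoped Matrix ComplexOrder

theorem border_row_three_psd (n : ℕ) (A P1 P2 P3 : Matrix (Fin n) (Fin n) ℂ)
    (hP1 : P1.PosSemidef) (hP2 : P2.PosDef) (hP3 : P3.PosDef)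
    (hA : A = P1 * P2 * P3) (Y : Matrix (Fin 1) (Fin n) ℂ) :
    ∃ Q1 Q2 Q3 : Matrix (Fin n ⊕ Fin 1) (Fin n ⊕ Fin 1) ℂ,
      Q1.PosSemidef ∧ Q2.PosSemidef ∧ Q3.PosSemidef ∧
      Matrix.fromBlocks A 0 Y (0 : Matrix (Fin 1) (Fin 1) ℂ) = Q1 * Q2 * Q3 := by
  have := hP2.isUnit.invertible
  set Z := Y * P3⁻¹ with hZ
  refine ⟨Matrix.fromBlocks P1 0 0 1, Matrix.fromBlocks P2 Zᴴ Z (Z * P2⁻¹ * Zᴴ),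
    Matrix.fromBlocks P3 0 0 0, ?_, ?_, ?_, ?_⟩
  · have := invertibleOne (α := Matrix (Fin 1) (Fin 1) ℂ)
    have h := (Matrix.PosDef.fromBlocks₂₂ P1 (0 : Matrix (Fin n) (Fin 1) ℂ)
      Matrix.PosDef.one).2 (by simpa using hP1)
    simpa using h
  · have h := (Matrix.PosDef.fromBlocks₁₁ Zᴴ (Z * P2⁻¹ * Zᴴ) hP2).2
      (by simpa using Matrix.PosSemidef.zero)
    simpa using h
  · have := hP3.isUnit.invertible
    have h := (Matrix.PosDef.fromBlocks₁₁ (0 : Matrix (Fin n) (Fin 1) ℂ) 0 hP3).2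
      (by simpa using Matrix.PosSemidef.zero)
    simpa using h
  · have hY : Z * P3 = Y := by
      rw [hZ, Matrix.mul_assoc, Matrix.nonsing_inv_mul _
        ((Matrix.isUnit_iff_isUnit_det _).1 hP3.isUnit), Matrix.mul_one]
    simp [Matrix.fromBlocks_multiply, hA, hY]
end

section
/- Let m, p ≥ 1, let T1 be an invertible m×m complex matrix, and let T2 be a nonzero nilpotent p×p complex matrix. Then the (m+p)×(m+p) block diagonal matrix T = T1 ⊕ T2 is a product of three positive semi-definite matrices. -/
open scoped Matrix ComplexOrder

namespace Matrix

variable {l n w h : Type} [Fintype l] [Fintype n] [Fintype w] [Fintype h]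
  [DecidableEq n] [DecidableEq w] [DecidableEq h]

/-- `A` is a product of two positive definite matrices. -/
def IsProdTwoPosDef (A : Matrix n n ℂ) : Prop :=
  ∃ P Q : Matrix n n ℂ, P.PosDef ∧ Q.PosDef ∧ A = P * Q

omit [DecidableEq n] in
theorem mulVec_injective_of_left_inverse {S : Matrix n w ℂ} {R : Matrix w n ℂ}
    (hRS : R * S = 1) : Function.Injective S.mulVec :=
  Function.LeftInverse.injective (g := R.mulVec) fun v => by simp [hRS]

omit [DecidableEq w] in
theorem PosDef.congr_of_right_inverse {P : Matrix w w ℂ} (hP : P.PosDef) {S : Matrix n w ℂ}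
    {R : Matrix w n ℂ} (hSR : S * R = 1) : (S * P * Sᴴ).PosDef := by
  have hinj : Function.Injective (Sᴴ).mulVec :=
    mulVec_injective_of_left_inverse (R := Rᴴ) (by rw [← conjTranspose_mul, hSR, conjTranspose_one])
  simpa using hP.conjTranspose_mul_mul_same hinj

theorem IsProdTwoPosDef.conj {A : Matrix w w ℂ} (hA : IsProdTwoPosDef A) {S : Matrix n w ℂ}
    {R : Matrix w n ℂ} (hSR : S * R = 1) (hRS : R * S = 1) : IsProdTwoPosDef (S * A * R) := by
  obtain ⟨P, Q, hP, hQ, rfl⟩ := hA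
  refine ⟨S * P * Sᴴ, Rᴴ * Q * R, hP.congr_of_right_inverse hSR,
    hQ.conjTranspose_mul_mul_same (mulVec_injective_of_left_inverse hSR), ?_⟩
  have hSR' : Sᴴ * Rᴴ = 1 := by rw [← conjTranspose_mul, hRS, conjTranspose_one]
  calc S * (P * Q) * R = S * P * (1 : Matrix w w ℂ) * Q * R := by
        simp only [Matrix.mul_assoc, Matrix.one_mul]
    _ = _ := by rw [← hSR']; simp only [Matrix.mul_assoc]

omit [Fintype w] [Fintype h] [DecidableEq w] [DecidableEq h] in
theorem PosDef.fromBlocks_diag [Finite w] [Finite h] {P : Matrix w w ℂ} {Q : Matrix h h ℂ}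
    (hP : P.PosDef) (hQ : Q.PosDef) : (fromBlocks P 0 0 Q).PosDef := by
  classical
  have := Fintype.ofFinite w
  have := Fintype.ofFinite h
  refine .of_dotProduct_mulVec_pos (hP.1.fromBlocks (by simp) hQ.1) fun x hx => ?_
  have hx' : x = Sum.elim (x ∘ Sum.inl) (x ∘ Sum.inr) := (Sum.elim_comp_inl_inr x).symm
  have key : star x ⬝ᵥ (fromBlocks P 0 0 Q *ᵥ x) =
      star (x ∘ Sum.inl) ⬝ᵥ (P *ᵥ (x ∘ Sum.inl)) + star (x ∘ Sum.inr) ⬝ᵥ (Q *ᵥ (x ∘ Sum.inr)) := by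
    simp [fromBlocks_mulVec, dotProduct, Fintype.sum_sum_type]
  rw [key]
  by_cases h1 : x ∘ Sum.inl = 0
  · have h2 : x ∘ Sum.inr ≠ 0 := fun h2 => hx (by rw [hx', h1, h2]; ext (i | i) <;> rfl)
    exact add_pos_of_nonneg_of_pos (hP.posSemidef.dotProduct_mulVec_nonneg _)
      (hQ.dotProduct_mulVec_pos h2)
  · exact add_pos_of_pos_of_nonneg (hP.dotProduct_mulVec_pos h1)
      (hQ.posSemidef.dotProduct_mulVec_nonneg _)

/-- Mutually inverse matrices `[S₁ S₂]` and `[R₁; R₂]` in which the columns of `S₂` span the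
kernel of `B`, together with `C` such that `R₁ = C * B`. -/
structure KernelFrame (B : Matrix l n ℂ) (w h : Type) [Fintype w] [Fintype h]
    [DecidableEq w] [DecidableEq h] where
  S₁ : Matrix n w ℂ
  S₂ : Matrix n h ℂ
  R₂ : Matrix h n ℂ
  C : Matrix w l ℂ
  mul_S₂ : B * S₂ = 0
  left₁₁ : C * B * S₁ = 1
  left₂₁ : R₂ * S₁ = 0
  left₂₂ : R₂ * S₂ = 1
  right : S₁ * (C * B) + S₂ * R₂ = 1

theorem exists_kernelFrame (B : Matrix l n ℂ) :
    ∃ w h : ℕ, Nonempty (KernelFrame B (Fin w) (Fin h)) := by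
  classical
  set f : (n → ℂ) →ₗ[ℂ] (l → ℂ) := Matrix.toLin' B with hf
  let e := (Module.finBasis ℂ (LinearMap.range f)).equivFun
  let k := (Module.finBasis ℂ (LinearMap.ker f)).equivFun
  obtain ⟨c, hc⟩ := (LinearMap.range f).subtype.exists_leftInverse_of_injective
    (Submodule.ker_subtype _)
  have hcf : ∀ x, c (f x) = f.rangeRestrict x := fun x =>
    LinearMap.congr_fun hc (f.rangeRestrict x)
  obtain ⟨s, hs⟩ := f.rangeRestrict.exists_rightInverse_of_surjective f.range_rangeRestrict
  have hfs : ∀ y, f (s y) = y := fun y => congrArg Subtype.val (LinearMap.congr_fun hs y)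
  have hmem : ∀ x, x - s (c (f x)) ∈ LinearMap.ker f := fun x => by
    rw [LinearMap.mem_ker, map_sub, hfs, hcf]; simp
  have hcr : ∀ y : LinearMap.range f, c y = y := fun y => LinearMap.congr_fun hc y
  let r : (n → ℂ) →ₗ[ℂ] LinearMap.ker f :=
    (LinearMap.id - s ∘ₗ c ∘ₗ f).codRestrict _ hmem
  have hr : ∀ x, (r x : n → ℂ) = x - s (c (f x)) := fun x => rfl
  have hB : B = LinearMap.toMatrix' f := by simp [hf]
  refine ⟨_, _, ⟨{
    S₁ := LinearMap.toMatrix' (s ∘ₗ e.symm.toLinearMap)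
    S₂ := LinearMap.toMatrix' ((LinearMap.ker f).subtype ∘ₗ k.symm.toLinearMap)
    R₂ := LinearMap.toMatrix' (k.toLinearMap ∘ₗ r)
    C := LinearMap.toMatrix' (e.toLinearMap ∘ₗ c)
    mul_S₂ := ?_
    left₁₁ := ?_
    left₂₁ := ?_
    left₂₂ := ?_
    right := ?_ }⟩⟩
  · rw [hB, ← LinearMap.toMatrix'_comp, ← map_zero LinearMap.toMatrix']
    congr 1
    refine LinearMap.ext fun x => ?_
    exact (k.symm x).2
  · rw [hB, ← LinearMap.toMatrix'_comp, ← LinearMap.toMatrix'_comp, ← LinearMap.toMatrix'_id]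
    congr 1
    refine LinearMap.ext fun x => ?_
    simp [hfs, hcr]
  · rw [← LinearMap.toMatrix'_comp, ← map_zero LinearMap.toMatrix']
    congr 1
    refine LinearMap.ext fun x => ?_
    have : r (s (e.symm x)) = 0 := Subtype.ext (by rw [hr, hfs, hcr]; simp)
    simp [this]
  · rw [← LinearMap.toMatrix'_comp, ← LinearMap.toMatrix'_id]
    congr 1
    refine LinearMap.ext fun x => ?_
    have h0 : f (k.symm x : n → ℂ) = 0 := (k.symm x).2
    have : r (k.symm x) = k.symm x := Subtype.ext (by rw [hr, h0]; simp)
    simp [this]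
  · rw [hB, ← LinearMap.toMatrix'_comp, ← LinearMap.toMatrix'_comp, ← LinearMap.toMatrix'_comp,
      ← map_add, ← LinearMap.toMatrix'_id]
    congr 1
    refine LinearMap.ext fun x => ?_
    simp [hr]

namespace KernelFrame

variable {B : Matrix l n ℂ} (K : KernelFrame B w h)

def S : Matrix n (w ⊕ h) ℂ := fromCols K.S₁ K.S₂

def R : Matrix (w ⊕ h) n ℂ := fromRows (K.C * B) K.R₂

theorem S_mul_R : K.S * K.R = 1 := by
  rw [S, R, fromCols_mul_fromRows, K.right]

theorem R_mul_S : K.R * K.S = 1 := by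
  rw [S, R, fromRows_mul_fromCols, K.left₁₁, K.left₂₁, K.left₂₂, Matrix.mul_assoc, K.mul_S₂,
    Matrix.mul_zero, fromBlocks_one]

include K in
theorem card_eq : Fintype.card n = Fintype.card w + Fintype.card h := by
  rw [Matrix.square_of_invertible _ _ K.S_mul_R K.R_mul_S, Fintype.card_sum]

theorem mul_S₁_mul : B * K.S₁ * (K.C * B) = B := by
  have := congrArg (B * ·) K.right
  simpa [Matrix.mul_add, ← Matrix.mul_assoc, K.mul_S₂] using this

theorem eq_zero_of_mulVec {v : n → ℂ} (h₁ : K.S₁ᴴ *ᵥ v = 0) (h₂ : K.S₂ᴴ *ᵥ v = 0) : v = 0 := by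
  have hone := congrArg conjTranspose K.right
  rw [conjTranspose_add, conjTranspose_mul, conjTranspose_mul K.S₂, conjTranspose_one] at hone
  rw [← Matrix.one_mulVec v, ← hone, Matrix.add_mulVec, ← mulVec_mulVec, ← mulVec_mulVec, h₁, h₂,
    mulVec_zero, mulVec_zero, add_zero]

include K in
theorem nonempty_of_ne_zero (hB : B ≠ 0) : Nonempty w := by
  by_contra hw
  rw [not_nonempty_iff] at hw
  apply hB
  rw [← K.mul_S₁_mul, Subsingleton.elim (K.C * B) 0, Matrix.mul_zero]

/-- Adding combinations of the columns of `S₂` to those of `S₁`. -/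
def shear (y : Matrix h w ℂ) : KernelFrame B w h where
  S₁ := K.S₁ + K.S₂ * y
  S₂ := K.S₂
  R₂ := K.R₂ - y * (K.C * B)
  C := K.C
  mul_S₂ := K.mul_S₂
  left₁₁ := by
    rw [Matrix.mul_add, K.left₁₁, Matrix.mul_assoc, ← Matrix.mul_assoc B, K.mul_S₂]; simp
  left₂₁ := by
    rw [Matrix.mul_add, Matrix.sub_mul, K.left₂₁, Matrix.mul_assoc y, K.left₁₁,
      ← Matrix.mul_assoc, Matrix.sub_mul, K.left₂₂, Matrix.mul_assoc y, Matrix.mul_assoc K.C,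
      K.mul_S₂]
    simp
  left₂₂ := by
    rw [Matrix.sub_mul, K.left₂₂, Matrix.mul_assoc y, Matrix.mul_assoc K.C, K.mul_S₂]; simp
  right := by
    rw [← K.right, Matrix.add_mul, Matrix.mul_sub, Matrix.mul_assoc]; abel

end KernelFrame

theorem exists_pos_isUnit_smul_one_sub (A : Matrix h h ℂ) :
    ∃ a : ℝ, 0 < a ∧ IsUnit ((a : ℂ) • (1 : Matrix h h ℂ) - A) := by
  have hfin : (Complex.ofReal ⁻¹' spectrum ℂ A).Finite :=
    A.finite_spectrum.preimage Complex.ofReal_injective.injOn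
  obtain ⟨a, ha, hna⟩ := (Set.Ioi_infinite (0 : ℝ)).exists_notMem_finite hfin
  refine ⟨a, ha, ?_⟩
  simpa [spectrum.mem_iff, Algebra.algebraMap_eq_smul_one] using hna

theorem exists_posDef_blocks_isProdTwoPosDef (M₁₁ : Matrix w w ℂ) (M₁₂ : Matrix w h ℂ)
    (M₂₁ : Matrix h w ℂ) (M₂₂ : Matrix h h ℂ) {G : Matrix h h ℂ} (hG : G.PosDef)
    {X : Matrix h w ℂ} (hX : IsProdTwoPosDef (G * M₂₂ + X * M₁₂)) :
    ∃ (G' : Matrix (w ⊕ h) (w ⊕ h) ℂ) (Z : Matrix (w ⊕ h) w ℂ), G'.PosDef ∧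
      IsProdTwoPosDef (G' * fromBlocks M₁₁ M₁₂ M₂₁ M₂₂ + fromCols Z 0) := by
  set A := G * M₂₂ + X * M₁₂ with hA
  obtain ⟨a, ha, hu⟩ := exists_pos_isUnit_smul_one_sub A
  obtain ⟨Y, hY⟩ : ∃ Y : Matrix w h ℂ, (a : ℂ) • Y - Y * A = M₁₂ := by
    refine ⟨M₁₂ * ((a : ℂ) • (1 : Matrix h h ℂ) - A)⁻¹, ?_⟩
    rw [isUnit_iff_isUnit_det] at hu
    have := nonsing_inv_mul_cancel_right _ M₁₂ hu
    rwa [Matrix.mul_sub, Matrix.mul_smul, Matrix.mul_one] at this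
  have hdiag : IsProdTwoPosDef (fromBlocks ((a : ℂ) • (1 : Matrix w w ℂ)) 0 0 A) := by
    obtain ⟨P, Q, hP, hQ, hPQ⟩ := hX
    refine ⟨fromBlocks ((a : ℂ) • 1) 0 0 P, fromBlocks 1 0 0 Q,
      PosDef.fromBlocks_diag (PosDef.one.smul (by exact_mod_cast ha)) hP,
      PosDef.fromBlocks_diag .one hQ, ?_⟩
    simp [fromBlocks_multiply, hPQ]
  have hconj := hdiag.conj
    (S := fromBlocks 1 0 (-X) 1 * fromBlocks (1 : Matrix w w ℂ) (-Y) 0 (1 : Matrix h h ℂ))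
    (R := fromBlocks 1 Y 0 1 * fromBlocks 1 0 X 1)
    (by
      rw [Matrix.mul_assoc, ← Matrix.mul_assoc (fromBlocks 1 (-Y) 0 1), fromBlocks_multiply 1 (-Y)]
      simp [fromBlocks_multiply])
    (by
      rw [Matrix.mul_assoc, ← Matrix.mul_assoc (fromBlocks 1 0 X 1), fromBlocks_multiply 1 0 X]
      simp [fromBlocks_multiply])
  refine ⟨fromBlocks 1 0 0 G, fromRows ((a : ℂ) • 1 + M₁₂ * X - M₁₁)
    (-((a : ℂ) • X) - X * M₁₂ * X + A * X - G * M₂₁), PosDef.fromBlocks_diag .one hG, ?_⟩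
  convert hconj using 1
  rw [← fromRows_zero, fromCols_fromRows_eq_fromBlocks, fromBlocks_multiply, fromBlocks_multiply,
    fromBlocks_multiply, fromBlocks_multiply, fromBlocks_multiply, fromBlocks_add, ← hY]
  have hD : G * M₂₂ = A - X * ((a : ℂ) • Y - Y * A) := by rw [hY, hA]; abel
  rw [hD]
  congr 1 <;> simp [Matrix.mul_add, Matrix.mul_sub, Matrix.add_mul, Matrix.sub_mul,
    Matrix.mul_assoc] <;> abel_nf

/-- If `M` is injective on the kernel of `B ≠ 0`, then some positive definite multiple of `M` agrees
on that kernel with a product of two positive definite matrices. -/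
theorem exists_posDef_isProdTwoPosDef (M : Matrix n n ℂ) (B : Matrix l n ℂ) (hB : B ≠ 0)
    (hMB : ∀ v, M *ᵥ v = 0 → B *ᵥ v = 0 → v = 0) :
    ∃ (G : Matrix n n ℂ) (X : Matrix n l ℂ), G.PosDef ∧ IsProdTwoPosDef (G * M + X * B) := by
  induction hN : Fintype.card n using Nat.strong_induction_on generalizing l n with
  | _ N ih =>
  subst hN
  obtain ⟨w, h, ⟨K⟩⟩ := exists_kernelFrame B
  have hw := K.nonempty_of_ne_zero hB
  rcases isEmpty_or_nonempty (Fin h) with hh | hh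
  · refine ⟨1, (1 - M) * K.S₁ * K.C, .one, 1, 1, .one, .one, ?_⟩
    have : K.S₁ * (K.C * B) = 1 := by
      rw [← K.right, Subsingleton.elim K.R₂ 0]; simp
    simp [Matrix.mul_assoc, this]
  have hinj : ∀ (K' : KernelFrame B (Fin w) (Fin h)) (v : Fin h → ℂ),
      (K'.S₂ᴴ * M * K'.S₂) *ᵥ v = 0 → (K'.S₁ᴴ * M * K'.S₂) *ᵥ v = 0 → v = 0 := by
    intro K' v h2 h1
    have hv : K'.S₂ *ᵥ v = 0 := by
      apply hMB
      · apply K'.eq_zero_of_mulVec <;> simpa [← Matrix.mul_assoc]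
      · simp [K'.mul_S₂]
    rw [← Matrix.one_mulVec v, ← K'.left₂₂, ← mulVec_mulVec, hv, mulVec_zero]
  obtain ⟨K, hd⟩ : ∃ K : KernelFrame B (Fin w) (Fin h), K.S₁ᴴ * M * K.S₂ ≠ 0 := by
    by_cases hd : K.S₁ᴴ * M * K.S₂ = 0
    · have hE : K.S₂ᴴ * M * K.S₂ ≠ 0 := fun hE =>
        one_ne_zero (funext_iff.1 (hinj K 1 (by simp [hE]) (by simp [hd])) (Classical.arbitrary _))
      obtain ⟨i, j, hij⟩ : ∃ i j, (K.S₂ᴴ * M * K.S₂) i j ≠ 0 := by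
        by_contra! hc
        exact hE (Matrix.ext hc)
      obtain ⟨a⟩ := hw
      refine ⟨K.shear (single i a 1), fun hs => hij ?_⟩
      have hs' : single a i (1 : ℂ) * (K.S₂ᴴ * M * K.S₂) = 0 := by
        simpa [KernelFrame.shear, Matrix.add_mul, hd, Matrix.mul_assoc] using hs
      simpa using congrFun (congrFun hs' a) j
    · exact ⟨K, hd⟩
  have hlt : Fintype.card (Fin h) < Fintype.card n := by
    have := K.card_eq
    have := Fintype.card_pos_iff.2 hw
    omega
  obtain ⟨G, X, hG, hX⟩ := ih _ hlt (K.S₂ᴴ * M * K.S₂) (K.S₁ᴴ * M * K.S₂) hd (hinj K) rfl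
  obtain ⟨G', Z, hG', hZ⟩ := exists_posDef_blocks_isProdTwoPosDef (K.S₁ᴴ * M * K.S₁) _
    (K.S₂ᴴ * M * K.S₁) _ hG hX
  refine ⟨K.S * G' * K.Sᴴ, K.S * Z * K.C, hG'.congr_of_right_inverse K.S_mul_R, ?_⟩
  convert hZ.conj K.S_mul_R K.R_mul_S using 1
  have hblocks : fromBlocks (K.S₁ᴴ * M * K.S₁) (K.S₁ᴴ * M * K.S₂) (K.S₂ᴴ * M * K.S₁)
      (K.S₂ᴴ * M * K.S₂) = K.Sᴴ * M * K.S := by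
    rw [KernelFrame.S, conjTranspose_fromCols_eq_fromRows_conjTranspose, fromRows_mul,
      fromRows_mul_fromCols]
  have hZR : fromCols Z (0 : Matrix (Fin w ⊕ Fin h) (Fin h) ℂ) * K.R = Z * (K.C * B) := by
    rw [KernelFrame.R, fromCols_mul_fromRows]; simp
  rw [hblocks, Matrix.mul_add, Matrix.add_mul, Matrix.mul_assoc K.S (fromCols Z 0), hZR]
  simp only [Matrix.mul_assoc, K.S_mul_R, Matrix.mul_one]

/-- A matrix that is nonzero and vanishes twice along some `N` is a product of three positive
semi-definite matrices. -/
theorem exists_three_posSemidef_of_mul_mul_eq_zero (T N : Matrix n n ℂ) (hTN : T * N ≠ 0)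
    (hTTN : T * (T * N) = 0) :
    ∃ P₁ P₂ P₃ : Matrix n n ℂ, P₁.PosSemidef ∧ P₂.PosSemidef ∧ P₃.PosSemidef ∧
      T = P₁ * P₂ * P₃ := by
  obtain ⟨w, h, ⟨K⟩⟩ := exists_kernelFrame T
  set F := T * K.S₁ with hF
  have hT : T = F * (K.C * T) := K.mul_S₁_mul.symm
  have hCF : K.C * F = 1 := by rw [hF, ← Matrix.mul_assoc, K.left₁₁]
  have hB : K.S₂ᴴ * F ≠ 0 := by
    intro hB
    have hV : T * N = K.S₂ * (K.R₂ * (T * N)) := by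
      rw [← Matrix.one_mul (T * N), ← K.right, Matrix.add_mul, Matrix.mul_assoc K.S₁,
        Matrix.mul_assoc K.C, hTTN]
      simp [← Matrix.mul_assoc, K.left₂₂]
    apply hTN
    rw [← conjTranspose_mul_self_eq_zero]
    have hV' : K.S₂ᴴ * (T * N) = 0 := by
      calc K.S₂ᴴ * (T * N) = K.S₂ᴴ * (F * (K.C * T) * N) := by rw [← hT]
        _ = 0 := by simp only [← Matrix.mul_assoc, hB, Matrix.zero_mul]
    calc (T * N)ᴴ * (T * N) = (K.S₂ * (K.R₂ * (T * N)))ᴴ * (T * N) := by rw [← hV]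
      _ = 0 := by rw [conjTranspose_mul, Matrix.mul_assoc, hV', Matrix.mul_zero]
  obtain ⟨G₂, X, hG₂, hA⟩ := exists_posDef_isProdTwoPosDef (K.S₁ᴴ * F) (K.S₂ᴴ * F) hB <| by
    intro v h1 h2
    have hv : F *ᵥ v = 0 := K.eq_zero_of_mulVec (by simpa using h1) (by simpa using h2)
    rw [← Matrix.one_mulVec v, ← hCF, ← mulVec_mulVec, hv, mulVec_zero]
  set A := G₂ * (K.S₁ᴴ * F) + X * (K.S₂ᴴ * F) with hAdef
  have hG₂u := (isUnit_iff_isUnit_det _).1 hG₂.isUnit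
  let L := K.shear (G₂⁻¹ * X)ᴴ
  let G : Matrix n n ℂ := L.S * fromBlocks G₂ 0 0 (1 : Matrix (Fin h) (Fin h) ℂ) * L.Sᴴ
  have hG : G.PosDef := (PosDef.fromBlocks_diag hG₂ .one).congr_of_right_inverse L.S_mul_R
  have hCS : K.C * T * L.S = fromCols 1 0 := by
    have h1 : K.C * T * L.S₁ = 1 := L.left₁₁
    rw [KernelFrame.S, mul_fromCols, h1, Matrix.mul_assoc, L.mul_S₂, Matrix.mul_zero]
  have hGF : K.C * T * G * F = A := by
    simp only [G]
    rw [← Matrix.mul_assoc (K.C * T), ← Matrix.mul_assoc (K.C * T), hCS, fromCols_mul_fromBlocks, KernelFrame.S,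
      conjTranspose_fromCols_eq_fromRows_conjTranspose, fromCols_mul_fromRows]
    simp [L, KernelFrame.shear, Matrix.mul_add, Matrix.add_mul, Matrix.mul_assoc, hAdef,
      mul_nonsing_inv_cancel_left _ _ hG₂u]
  obtain ⟨P, Q, hP, hQ, hPQ⟩ := hA
  have hAu : IsUnit A.det := by
    rw [hPQ, ← isUnit_iff_isUnit_det]; exact hP.isUnit.mul hQ.isUnit
  set J := A⁻¹ * (K.C * T * G) with hJ
  have hJF : J * F = 1 := by rw [hJ, Matrix.mul_assoc, hGF, nonsing_inv_mul _ hAu]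
  have hAJ : A * J = K.C * T * G := mul_nonsing_inv_cancel_left _ _ hAu
  refine ⟨F * P * Fᴴ, Jᴴ * Q * J, G⁻¹, hP.posSemidef.mul_mul_conjTranspose_same _,
    hQ.posSemidef.conjTranspose_mul_mul_same _, hG.inv.posSemidef, ?_⟩
  have hFJ : Fᴴ * Jᴴ = 1 := by rw [← conjTranspose_mul, hJF, conjTranspose_one]
  have hTG : F * P * Fᴴ * (Jᴴ * Q * J) = T * G := by
    calc F * P * Fᴴ * (Jᴴ * Q * J) = F * P * (Fᴴ * Jᴴ) * Q * J := by simp only [Matrix.mul_assoc]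
      _ = F * (P * Q * J) := by rw [hFJ]; simp only [Matrix.mul_assoc, Matrix.one_mul]
      _ = T * G := by rw [← hPQ, hAJ, ← Matrix.mul_assoc, ← hT]
  rw [hTG, mul_nonsing_inv_cancel_right _ _ ((isUnit_iff_isUnit_det _).1 hG.isUnit)]

end Matrix

theorem block_diag_nonzero_nilpotent_three_psd (m p : ℕ) (hm : 1 ≤ m) (hp : 1 ≤ p)
    (T1 : Matrix (Fin m) (Fin m) ℂ) (T2 : Matrix (Fin p) (Fin p) ℂ)
    (hT1 : IsUnit T1) (hT2 : IsNilpotent T2) (hT2' : T2 ≠ 0) :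
    ∃ P1 P2 P3 : Matrix (Fin m ⊕ Fin p) (Fin m ⊕ Fin p) ℂ,
      P1.PosSemidef ∧ P2.PosSemidef ∧ P3.PosSemidef ∧
      Matrix.fromBlocks T1 0 0 T2 = P1 * P2 * P3 := by
  obtain ⟨N, hN, hN'⟩ : ∃ N, T2 * N ≠ 0 ∧ T2 * (T2 * N) = 0 := by
    by_contra! hc
    obtain ⟨k, hk⟩ := hT2
    have hpow : ∀ j, T2 * T2 ^ j ≠ 0 := fun j => by
      induction j with
      | zero => simpa using hT2'
      | succ j ih => rw [pow_succ']; exact hc _ ih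
    exact hpow k (by rw [hk, mul_zero])
  refine Matrix.exists_three_posSemidef_of_mul_mul_eq_zero _ (Matrix.fromBlocks 0 0 0 N) ?_ ?_
  · rw [Matrix.fromBlocks_multiply]
    intro h0
    apply hN
    simpa [← Matrix.fromBlocks_zero] using congrArg Matrix.toBlocks₂₂ h0
  · simp [Matrix.fromBlocks_multiply, hN']
end

section
/- An n×n complex matrix A is a product of two positive semi-definite matrices if and only if A is similar to a diagonal matrix whose diagonal entries are nonnegative real numbers. -/
open scoped Matrix ComplexOrder

/-- The eigenvectors of `M`, together with `0`, whose eigenvalue is a nonnegative real number. -/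
def Matrix.nonnegEigenvectors {n : Type*} [Fintype n] (M : Matrix n n ℂ) : Set (n → ℂ) :=
  {v | ∃ μ : ℝ, 0 ≤ μ ∧ M *ᵥ v = (μ : ℂ) • v}

namespace Matrix

variable {n : Type*} [Fintype n]

theorem PosSemidef.span_nonnegEigenvectors [DecidableEq n] {M : Matrix n n ℂ}
    (hM : M.PosSemidef) : Submodule.span ℂ M.nonnegEigenvectors = ⊤ := by
  rw [eq_top_iff, ← (hM.1.eigenvectorBasis.toBasis.map (WithLp.linearEquiv 2 ℂ (n → ℂ))).span_eq]
  refine Submodule.span_mono ?_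
  rintro _ ⟨i, rfl⟩
  refine ⟨hM.1.eigenvalues i, hM.eigenvalues_nonneg i, ?_⟩
  simpa using hM.1.mulVec_eigenvectorBasis i

/-- If `x` is killed by `(B * C) ^ 2`, it is killed by `B * C`. -/
theorem PosSemidef.mulVec_mul_eq_zero {B C : Matrix n n ℂ} (hB : B.PosSemidef)
    (hC : C.PosSemidef) {x : n → ℂ} (hx : (B * C) *ᵥ (B * C) *ᵥ x = 0) : (B * C) *ᵥ x = 0 := by
  simp only [← mulVec_mulVec] at hx ⊢
  have hCB : C *ᵥ B *ᵥ C *ᵥ x = 0 := by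
    rw [← hC.dotProduct_mulVec_zero_iff, star_mulVec, hB.1.eq, ← dotProduct_mulVec, hx,
      dotProduct_zero]
  rw [← hB.dotProduct_mulVec_zero_iff, star_mulVec, hC.1.eq, ← dotProduct_mulVec, hCB,
    dotProduct_zero]

open scoped MatrixOrder in
theorem PosSemidef.span_nonnegEigenvectors_mul [DecidableEq n] {B C : Matrix n n ℂ}
    (hB : B.PosSemidef) (hC : C.PosSemidef) :
    Submodule.span ℂ (B * C).nonnegEigenvectors = ⊤ := by
  have hcompl : IsCompl (LinearMap.ker (B * C).mulVecLin) (LinearMap.range (B * C).mulVecLin) := by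
    refine (Submodule.isCompl_iff_disjoint _ _ ?_).2 (Submodule.disjoint_def.2 ?_)
    · rw [add_comm, LinearMap.finrank_range_add_finrank_ker]
    · rintro _ hx ⟨x, rfl⟩
      exact hB.mulVec_mul_eq_zero hC hx
  rw [eq_top_iff, ← hcompl.sup_eq_top]
  refine sup_le (fun x hx ↦ Submodule.subset_span ⟨0, le_rfl, ?_⟩) ?_
  · simpa using hx
  obtain ⟨N, rfl⟩ := CStarAlgebra.nonneg_iff_eq_star_mul_self.mp hB.nonneg
  have hle : Submodule.span ℂ (N * C * Nᴴ).nonnegEigenvectors ≤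
      (Submodule.span ℂ (star N * N * C).nonnegEigenvectors).comap Nᴴ.mulVecLin := by
    refine Submodule.span_le.2 ?_
    rintro v ⟨μ, hμ, hv⟩
    refine Submodule.subset_span ⟨μ, hμ, ?_⟩
    rw [mulVecLin_apply, ← mulVec_smul, ← hv]
    simp only [mulVec_mulVec, Matrix.mul_assoc, star_eq_conjTranspose]
  rw [(hC.mul_mul_conjTranspose_same N).span_nonnegEigenvectors] at hle
  rintro _ ⟨x, rfl⟩
  have := hle (Submodule.mem_top (x := (N * C) *ᵥ x))
  simpa [mulVec_mulVec, Matrix.mul_assoc, star_eq_conjTranspose] using this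

theorem exists_similar_diagonal_of_span_nonnegEigenvectors [DecidableEq n] {A : Matrix n n ℂ}
    (hA : Submodule.span ℂ A.nonnegEigenvectors = ⊤) :
    ∃ S : Matrix n n ℂ, IsUnit S ∧ ∃ d : n → ℝ, (∀ i, 0 ≤ d i) ∧
      A = S⁻¹ * diagonal (fun i => (d i : ℂ)) * S := by
  let b₀ := Module.Basis.ofSpan hA.ge
  let b := b₀.reindex (b₀.indexEquiv (Pi.basisFun ℂ n))
  have hb (i : n) : b i ∈ A.nonnegEigenvectors := by
    refine Module.Basis.ofSpan_subset hA.ge ?_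
    simp [b, b₀]
  choose d hd hAb using hb
  let Q : Matrix n n ℂ := of fun i j => b j i
  have hQ : IsUnit Q := linearIndependent_cols_iff_isUnit.1 b.linearIndependent
  have hAQ : A * Q = Q * diagonal (fun i => (d i : ℂ)) := by
    ext i j
    rw [mul_diagonal, mul_comm]
    exact congrFun (hAb j) i
  have hQdet := (isUnit_iff_isUnit_det Q).1 hQ
  refine ⟨Q⁻¹, isUnit_nonsing_inv_iff.2 hQ, d, hd, ?_⟩
  rw [nonsing_inv_nonsing_inv Q hQdet, ← hAQ, mul_nonsing_inv_cancel_right _ _ hQdet]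

theorem exists_posSemidef_mul_of_similar_diagonal [DecidableEq n] {S : Matrix n n ℂ}
    (hS : IsUnit S) {d : n → ℝ} (hd : ∀ i, 0 ≤ d i) :
    ∃ B C : Matrix n n ℂ, B.PosSemidef ∧ C.PosSemidef ∧
      S⁻¹ * diagonal (fun i => (d i : ℂ)) * S = B * C := by
  have hD : (diagonal (fun i => (d i : ℂ))).PosSemidef :=
    .diagonal fun i => by simpa using hd i
  refine ⟨S⁻¹ * S⁻¹ᴴ, Sᴴ * diagonal (fun i => (d i : ℂ)) * S,
    posSemidef_self_mul_conjTranspose _, hD.conjTranspose_mul_mul_same S, ?_⟩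
  have hSS : S⁻¹ᴴ * Sᴴ = 1 := by
    rw [← conjTranspose_mul, mul_nonsing_inv _ ((isUnit_iff_isUnit_det S).1 hS),
      conjTranspose_one]
  calc S⁻¹ * diagonal (fun i => (d i : ℂ)) * S
      = S⁻¹ * (S⁻¹ᴴ * Sᴴ) * diagonal (fun i => (d i : ℂ)) * S := by rw [hSS, Matrix.mul_one]
    _ = _ := by simp only [Matrix.mul_assoc]

end Matrix

theorem two_psd_iff_similar_nonneg_diagonal (n : ℕ) (A : Matrix (Fin n) (Fin n) ℂ) :
    (∃ B C : Matrix (Fin n) (Fin n) ℂ,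
      B.PosSemidef ∧ C.PosSemidef ∧ A = B * C) ↔
    (∃ S : Matrix (Fin n) (Fin n) ℂ, IsUnit S ∧
      ∃ d : Fin n → ℝ, (∀ i, 0 ≤ d i) ∧
        A = S⁻¹ * Matrix.diagonal (fun i => (d i : ℂ)) * S) := by
  constructor
  · rintro ⟨B, C, hB, hC, rfl⟩
    exact Matrix.exists_similar_diagonal_of_span_nonnegEigenvectors
      (hB.span_nonnegEigenvectors_mul hC)
  · rintro ⟨S, hS, d, hd, rfl⟩
    exact Matrix.exists_posSemidef_mul_of_similar_diagonal hS hd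
end

section
/- Let A be an n×n complex matrix that is similar to a diagonal matrix whose diagonal entries are nonnegative real numbers. Then A = BC where B is a positive definite n×n matrix and C is a positive semi-definite n×n matrix. -/
open scoped Matrix ComplexOrder

theorem pd_psd_factorization_of_similar_nonneg_diagonal (n : ℕ)
    (A : Matrix (Fin n) (Fin n) ℂ)
    (h : ∃ S : Matrix (Fin n) (Fin n) ℂ, IsUnit S ∧
      ∃ d : Fin n → ℝ, (∀ i, 0 ≤ d i) ∧
        A = S⁻¹ * Matrix.diagonal (fun i => (d i : ℂ)) * S) :
    ∃ B C : Matrix (Fin n) (Fin n) ℂ,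
      B.PosDef ∧ C.PosSemidef ∧ A = B * C := by
  obtain ⟨S, hS, d, hd, rfl⟩ := h
  have hdet : IsUnit S.det := (Matrix.isUnit_iff_isUnit_det S).1 hS
  refine ⟨S⁻¹ * S⁻¹ᴴ, Sᴴ * Matrix.diagonal (fun i => (d i : ℂ)) * S, ?_, ?_, ?_⟩
  · exact .mul_conjTranspose_self _
      (Matrix.vecMul_injective_of_isUnit (Matrix.isUnit_nonsing_inv_iff.2 hS))
  · exact (Matrix.PosSemidef.diagonal fun i =>
      Complex.zero_le_real.2 (hd i)).conjTranspose_mul_mul_same S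
  · have hinv : S⁻¹ᴴ * Sᴴ = 1 := by
      rw [← Matrix.conjTranspose_mul, Matrix.mul_nonsing_inv _ hdet, Matrix.conjTranspose_one]
    rw [Matrix.mul_assoc S⁻¹ S⁻¹ᴴ, Matrix.mul_assoc Sᴴ, ← Matrix.mul_assoc S⁻¹ᴴ, hinv,
      Matrix.one_mul, Matrix.mul_assoc]
end

section
/- The 2×2 real (viewed as complex) matrices P1 = [[9,3],[3,2]], P2 = [[13,−15],[−15,18]], and P3 = [[1,1],[1,1]] are each positive semi-definite, and their product satisfies P1·P2·P3 = [[−9,−9],[0,0]]. In particular, the matrix [[−9,−9],[0,0]] is a product of three positive semi-definite matrices, even though its upper-left 1×1 block [−9] is not a product of three positive definite matrices. -/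
open scoped Matrix ComplexOrder

theorem posSemidef_nine_three_three_two :
    (!![9, 3; 3, 2] : Matrix (Fin 2) (Fin 2) ℂ).PosSemidef := by
  have h := Matrix.posSemidef_conjTranspose_mul_self (!![3, 1; 0, 1] : Matrix (Fin 2) (Fin 2) ℂ)
  convert h using 1
  ext i j
  fin_cases i <;> fin_cases j <;> norm_num [Matrix.mul_apply, Complex.conj_ofNat, Fin.sum_univ_two]

theorem posSemidef_thirteen_neg_fifteen_eighteen :
    (!![13, -15; -15, 18] : Matrix (Fin 2) (Fin 2) ℂ).PosSemidef := by
  have h := Matrix.posSemidef_conjTranspose_mul_self (!![2, -3; 3, -3] : Matrix (Fin 2) (Fin 2) ℂ)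
  convert h using 1
  ext i j
  fin_cases i <;> fin_cases j <;> norm_num [Matrix.mul_apply, Complex.conj_ofNat, Fin.sum_univ_two]

theorem posSemidef_all_ones :
    (!![1, 1; 1, 1] : Matrix (Fin 2) (Fin 2) ℂ).PosSemidef := by
  have h := Matrix.posSemidef_conjTranspose_mul_self (!![1, 1; 0, 0] : Matrix (Fin 2) (Fin 2) ℂ)
  convert h using 1
  ext i j
  fin_cases i <;> fin_cases j <;> norm_num [Matrix.mul_apply, Fin.sum_univ_two]

theorem mul_mul_eq_neg_nine :
    (!![9, 3; 3, 2] : Matrix (Fin 2) (Fin 2) ℂ) * !![13, -15; -15, 18] * !![1, 1; 1, 1]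
      = !![-9, -9; 0, 0] := by
  ext i j
  fin_cases i <;> fin_cases j <;> norm_num [Matrix.mul_apply, Fin.sum_univ_two]

theorem example_one :
    (!![9, 3; 3, 2] : Matrix (Fin 2) (Fin 2) ℂ).PosSemidef ∧
    (!![13, -15; -15, 18] : Matrix (Fin 2) (Fin 2) ℂ).PosSemidef ∧
    (!![1, 1; 1, 1] : Matrix (Fin 2) (Fin 2) ℂ).PosSemidef ∧
    (!![9, 3; 3, 2] : Matrix (Fin 2) (Fin 2) ℂ) * !![13, -15; -15, 18] * !![1, 1; 1, 1]
      = !![-9, -9; 0, 0] ∧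
    (∃ P1 P2 P3 : Matrix (Fin 2) (Fin 2) ℂ,
      P1.PosSemidef ∧ P2.PosSemidef ∧ P3.PosSemidef ∧
      (!![-9, -9; 0, 0] : Matrix (Fin 2) (Fin 2) ℂ) = P1 * P2 * P3) ∧
    ¬ (∃ Q1 Q2 Q3 : Matrix (Fin 1) (Fin 1) ℂ,
      Q1.PosDef ∧ Q2.PosDef ∧ Q3.PosDef ∧
      (!![-9] : Matrix (Fin 1) (Fin 1) ℂ) = Q1 * Q2 * Q3) := by
  refine ⟨posSemidef_nine_three_three_two, posSemidef_thirteen_neg_fifteen_eighteen,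
    posSemidef_all_ones, mul_mul_eq_neg_nine,
    ⟨_, _, _, posSemidef_nine_three_three_two, posSemidef_thirteen_neg_fifteen_eighteen,
      posSemidef_all_ones, mul_mul_eq_neg_nine.symm⟩, ?_⟩
  rintro ⟨Q1, Q2, Q3, h1, h2, h3, h⟩
  have hpos : 0 < Q1 0 0 * Q2 0 0 * Q3 0 0 := mul_pos (mul_pos h1.diag_pos h2.diag_pos) h3.diag_pos
  have hentry : (-9 : ℂ) = Q1 0 0 * Q2 0 0 * Q3 0 0 := by
    simpa [Matrix.mul_apply] using congrFun (congrFun h 0) 0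
  rw [← hentry, Complex.lt_def] at hpos
  norm_num at hpos
end
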